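/- Let F be an algebraically closed field of characteristic 0, n ≥ 2, f ∈ F[X] a disintegrated polynomial of degree at least 2, and φ = (f,…,f) the diagonally split self-map of (P^1_F)^n. Let V be an irreducible φ-preperiodic subvariety of (P^1_F)^n with l := dim(V) > 0. Let I = {1,…,n} and let I_V be the set of indices i such that V is contained in a hypersurface x_i = ζ_i with ζ_i an f-preperiodic point. Then there exists a partition of I∖I_V into (ordered) subsets J_1,…,J_l such that, under the canonical isomorphism (P^1)^n ≅ (P^1)^{I_V} × (P^1)^{J_1} × … × (P^1)^{J_l}, one has V = (∏_{i∈I_V} {ζ_i}) × V_1 × … × V_l, where each V_k is an (f,…,f)-preperiodic curve in (P^1)^{J_k}. -/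

import Mathlib

open Polynomial OnePoint

/-- Action of a polynomial on the projective line `P^1(L) = L ∪ {∞}`:
`∞ ↦ ∞` and `a ↦ f(a)`. -/
def polyEvalP1 {L : Type} [CommRing L] (f : Polynomial L) : OnePoint L → OnePoint L :=
  OnePoint.map fun a => f.eval a

/-- The diagonally split self-map `(f,…,f)` of `(P^1)^n` (coordinatewise action). -/
def splitMap {L : Type} [CommRing L] {ι : Type} (f : Polynomial L)
    (x : ι → OnePoint L) : ι → OnePoint L :=
  fun i => polyEvalP1 f (x i)

/-- The forward orbit of a point under a self-map. -/
def fwdOrbit {X : Type*} (φ : X → X) (P : X) : Set X :=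
  Set.range fun k : ℕ => φ^[k] P

/-- Homogeneous coordinates of a point of `P^1(L)`: `a ↦ (a, 1)`, `∞ ↦ (1, 0)`. -/
def homCoords {L : Type} [CommRing L] (x : OnePoint L) : Fin 2 → L :=
  Option.elim x ![1, 0] (fun a => ![a, 1])

/-- A polynomial in variables `(i, 0), (i, 1)` (`i : ι`) is multihomogeneous if it is
homogeneous in the pair of variables indexed by each `i` separately. -/
def MultiHomog {K : Type} [CommSemiring K] {ι : Type} [DecidableEq ι]
    (p : MvPolynomial (ι × Fin 2) K) : Prop :=
  ∀ i : ι, ∃ d : ℕ,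
    p.IsWeightedHomogeneous (fun jk => if jk.1 = i then (1 : ℕ) else 0) d

/-- A closed subvariety of `(P^1_K)^ι`, given by a set of multihomogeneous equations over `K`. -/
structure ClosedSubvar (K : Type) [CommRing K] (ι : Type) [DecidableEq ι] where
  polys : Set (MvPolynomial (ι × Fin 2) K)
  homog : ∀ p ∈ polys, MultiHomog p

/-- Whether a multihomogeneous polynomial vanishes at a point of `(P^1(L))^ι`. -/
def vanishesAt {K : Type} [CommRing K] {ι : Type} [DecidableEq ι] {L : Type} [CommRing L]
    (φ : K →+* L) (p : MvPolynomial (ι × Fin 2) K) (x : ι → OnePoint L) : Prop :=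
  MvPolynomial.eval (fun jk => homCoords (x jk.1) jk.2) (MvPolynomial.map φ p) = 0

/-- The `L`-points of a closed subvariety, for a `K`-algebra `L` via `φ : K →+* L`. -/
def ClosedSubvar.pts {K : Type} [CommRing K] {ι : Type} [DecidableEq ι]
    (V : ClosedSubvar K ι) {L : Type} [CommRing L] (φ : K →+* L) :
    Set (ι → OnePoint L) :=
  {x | ∀ p ∈ V.polys, vanishesAt φ p x}

/-- A subset of `(P^1(L))^ι` is Zariski closed if it is the common zero set of a family of
multihomogeneous polynomials over `L`. -/
def IsZarClosed {L : Type} [CommRing L] {ι : Type} [DecidableEq ι]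
    (S : Set (ι → OnePoint L)) : Prop :=
  ∃ V : ClosedSubvar L ι, S = V.pts (RingHom.id L)

/-- The Zariski closure of a set of points. -/
def zarClosure {L : Type} [CommRing L] {ι : Type} [DecidableEq ι]
    (S : Set (ι → OnePoint L)) : Set (ι → OnePoint L) :=
  ⋂₀ {Z | IsZarClosed Z ∧ S ⊆ Z}

/-- An irreducible (closed) subvariety of `(P^1(L))^ι`, as a set of points. -/
def IrrSubvar {L : Type} [CommRing L] {ι : Type} [DecidableEq ι]
    (S : Set (ι → OnePoint L)) : Prop :=
  S.Nonempty ∧ IsZarClosed S ∧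
    ∀ Z₁ Z₂ : Set (ι → OnePoint L), IsZarClosed Z₁ → IsZarClosed Z₂ →
      S ⊆ Z₁ ∪ Z₂ → S ⊆ Z₁ ∨ S ⊆ Z₂

/-- The dimension of a (closed) subvariety, as the Krull dimension of the poset of
irreducible closed subsets contained in it. -/
noncomputable def varDim {L : Type} [CommRing L] {ι : Type} [DecidableEq ι]
    (S : Set (ι → OnePoint L)) : WithBot ℕ∞ :=
  Order.krullDim {T : Set (ι → OnePoint L) // IrrSubvar T ∧ T ⊆ S}

/-- `T` is an irreducible component of `S`: a maximal irreducible closed subset of `S`. -/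
def IsComponentOf {L : Type} [CommRing L] {ι : Type} [DecidableEq ι]
    (T S : Set (ι → OnePoint L)) : Prop :=
  IrrSubvar T ∧ T ⊆ S ∧ ∀ T', IrrSubvar T' → T ⊆ T' → T' ⊆ S → T' = T

/-- A hypersurface in `(P^1(L))^n`: a nonempty Zariski closed set all of whose irreducible
components have dimension `n - 1`. -/
def IsHypersurfaceSet {L : Type} [CommRing L] {n : ℕ}
    (S : Set (Fin n → OnePoint L)) : Prop :=
  S.Nonempty ∧ IsZarClosed S ∧
    ∀ T, IsComponentOf T S → varDim T = ((n - 1 : ℕ) : ℕ∞)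

/-- A set of points (e.g. a subvariety) is periodic under the split map `(f,…,f)`. -/
def SubvarPeriodic {L : Type} [CommRing L] {ι : Type} (f : Polynomial L)
    (S : Set (ι → OnePoint L)) : Prop :=
  ∃ m : ℕ, 1 ≤ m ∧ (splitMap f)^[m] '' S = S

/-- A set of points (e.g. a subvariety) is preparation under `(f,…,f)`. -/
def SubvarPreperiodic {L : Type} [CommRing L] {ι : Type} (f : Polynomial L)
    (S : Set (ι → OnePoint L)) : Prop :=
  ∃ k : ℕ, SubvarPeriodic f ((splitMap f)^[k] '' S)

/-- The `m`-th compositional iterate of a polynomial. -/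
noncomputable def polIter {F : Type} [CommSemiring F] (f : Polynomial F) : ℕ → Polynomial F
  | 0 => X
  | m + 1 => f.comp (polIter f m)

/-- Two polynomials commute under composition. -/
def PolyCommute {F : Type} [CommSemiring F] (f g : Polynomial F) : Prop :=
  f.comp g = g.comp f

/-- `g` commutes with some iterate `f^m` (`m ≥ 1`) of `f`. -/
def CommutesWithIterate {F : Type} [CommSemiring F] (f g : Polynomial F) : Prop :=
  ∃ m : ℕ, 1 ≤ m ∧ PolyCommute (polIter f m) g

/-- `c` is the Chebyshev polynomial of degree `d`, characterized by
`c(x + 1/x) = x^d + 1/x^d`. -/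
def IsChebyshevPoly {F : Type} [Field F] (d : ℕ) (c : Polynomial F) : Prop :=
  ∀ x : F, x ≠ 0 → c.eval (x + x⁻¹) = x ^ d + (x⁻¹) ^ d

/-- A polynomial over an algebraically closed field (or any field containing the relevant
conjugating data) is special if it is affinely conjugate to `X^d` or to `±C_d`. -/
def IsSpecialPolyAux {F : Type} [Field F] (f : Polynomial F) : Prop :=
  ∃ (a b : F), a ≠ 0 ∧
    ∃ g : Polynomial F,
      (g = X ^ f.natDegree ∨ IsChebyshevPoly f.natDegree g ∨
        IsChebyshevPoly f.natDegree (-g)) ∧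
      (C a * X + C b).comp g = f.comp (C a * X + C b)

/-- A polynomial over `K` is special if it becomes special (conjugate to `X^d` or `±C_d`)
over an algebraic closure of `K`. -/
def IsSpecialPoly {K : Type} [Field K] (f : Polynomial K) : Prop :=
  IsSpecialPolyAux (f.map (algebraMap K (AlgebraicClosure K)))

/-- A polynomial of degree at least 2 is disintegrated if it is not special. -/
def IsDisintegrated {K : Type} [Field K] (f : Polynomial K) : Prop :=
  2 ≤ f.natDegree ∧ ¬ IsSpecialPoly f

/-- A point of `P^1` is periodic under (the `P^1`-action of) a polynomial. -/
def P1Periodic {L : Type} [CommRing L] (f : Polynomial L) (ζ : OnePoint L) : Prop :=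
  ∃ N : ℕ, 1 ≤ N ∧ (OnePoint.map fun a => f.eval a)^[N] ζ = ζ

/-- A point of `P^1` is preperiodic under a polynomial. -/
def P1Preperiodic {L : Type} [CommRing L] (f : Polynomial L) (ζ : OnePoint L) : Prop :=
  ∃ k : ℕ, P1Periodic f ((OnePoint.map fun a => f.eval a)^[k] ζ)


/-- For an algebraically closed base field, `f` is disintegrated if it is not affinely
conjugate (over the field itself) to `X^d` or `±C_d`. -/
def IsDisintegratedAux {F : Type} [Field F] (f : Polynomial F) : Prop :=
  2 ≤ f.natDegree ∧ ¬ IsSpecialPolyAux f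

/-- `i ∈ I_V`: the subvariety (point set) `S` is contained in a hypersurface `x_i = ζ`
with `ζ` an `f`-preperiodic point of `P^1`. -/
def memIVpre {F : Type} [Field F] {n : ℕ} (f : Polynomial F)
    (S : Set (Fin n → OnePoint F)) (i : Fin n) : Prop :=
  ∃ ζ : OnePoint F, P1Preperiodic f ζ ∧ ∀ x ∈ S, x i = ζ

section PolynomialLemmas

variable {F : Type} [Field F]

theorem comp_ne_zero_of_natDegree_pos {f P : F[X]} (hf : 0 < f.natDegree) (hP : P ≠ 0) :
    P.comp f ≠ 0 := by
  intro h
  rcases comp_eq_zero_iff.1 h with h | ⟨-, h⟩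
  · exact hP h
  · rw [h, natDegree_C] at hf
    exact lt_irrefl _ hf

theorem sub_C_ne_zero_of_natDegree_pos {f : F[X]} (hf : 0 < f.natDegree) (b : F) :
    f - C b ≠ 0 := by
  intro h
  rw [sub_eq_zero.1 h, natDegree_C] at hf
  exact lt_irrefl _ hf

theorem rootMultiplicity_pow_eq (P : F[X]) (a : F) (k : ℕ) :
    (P ^ k).rootMultiplicity a = k * P.rootMultiplicity a := by
  classical
  rw [← count_roots, roots_pow, Multiset.count_nsmul, count_roots]

theorem rootMultiplicity_comp {f P : F[X]} (hf : 0 < f.natDegree) (hP : P ≠ 0) (a : F) :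
    (P.comp f).rootMultiplicity a =
      (f - C (f.eval a)).rootMultiplicity a * P.rootMultiplicity (f.eval a) := by
  obtain ⟨q, hq, hnd⟩ := exists_eq_pow_rootMultiplicity_mul_and_not_dvd P hP (f.eval a)
  set m := P.rootMultiplicity (f.eval a)
  have h1 : P.comp f = (f - C (f.eval a)) ^ m * q.comp f := by
    rw [hq]; simp
  have h0 := comp_ne_zero_of_natDegree_pos hf hP
  rw [h1] at h0 ⊢
  rw [rootMultiplicity_mul h0, rootMultiplicity_pow_eq, rootMultiplicity_eq_zero (p := q.comp f), mul_comm,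
    add_zero]
  rw [dvd_iff_isRoot] at hnd
  simpa [IsRoot, eval_comp] using hnd

theorem ramification_pos {f : F[X]} (hf : 0 < f.natDegree) (a : F) :
    0 < (f - C (f.eval a)).rootMultiplicity a := by
  rw [rootMultiplicity_pos (sub_C_ne_zero_of_natDegree_pos hf _)]
  simp

theorem rootMultiplicity_derivative_eq [CharZero F] (f : F[X]) (a : F) :
    f.derivative.rootMultiplicity a = (f - C (f.eval a)).rootMultiplicity a - 1 := by
  have := derivative_rootMultiplicity_of_root (p := f - C (f.eval a)) (t := a) (by simp)
  rwa [derivative_sub, derivative_C, sub_zero] at this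

theorem derivative_ne_zero_of_natDegree_pos [CharZero F] {f : F[X]} (hf : 0 < f.natDegree) :
    f.derivative ≠ 0 := by
  intro h
  have := derivative_eq_zero.1 h
  omega

theorem sum_rootMultiplicity_le (P : F[X]) (T : Finset F) :
    ∑ a ∈ T, P.rootMultiplicity a ≤ P.natDegree := by
  classical
  calc ∑ a ∈ T, P.rootMultiplicity a = ∑ a ∈ T, P.roots.count a := by simp
    _ ≤ ∑ a ∈ T ∪ P.roots.toFinset, P.roots.count a :=
        Finset.sum_le_sum_of_subset Finset.subset_union_left
    _ = P.roots.card := by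
        rw [Multiset.sum_count_eq_card]
        intro a ha
        simp [Multiset.mem_toFinset, ha, -mem_roots']
    _ ≤ P.natDegree := card_roots' P

theorem sum_rootMultiplicity_eq [IsAlgClosed F] {P : F[X]} (T : Finset F)
    (hT : ∀ a ∉ T, P.rootMultiplicity a = 0) :
    ∑ a ∈ T, P.rootMultiplicity a = P.natDegree := by
  classical
  rw [← splits_iff_card_roots.1 (IsAlgClosed.splits P)]
  simp only [← count_roots]
  apply Multiset.sum_count_eq_card
  intro a ha
  by_contra h
  have := hT a h
  rw [← count_roots, Multiset.count_eq_zero] at this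
  exact this ha

theorem eq_of_rootMultiplicity_eq [IsAlgClosed F] {P Q : F[X]}
    (hl : P.leadingCoeff = Q.leadingCoeff)
    (h : ∀ a, P.rootMultiplicity a = Q.rootMultiplicity a) : P = Q := by
  classical
  rw [(IsAlgClosed.splits P).eq_prod_roots, (IsAlgClosed.splits Q).eq_prod_roots, hl]
  congr 3
  ext a
  rw [count_roots, count_roots, h]

theorem isSpecialPolyAux_of_finite_backward_invariant [IsAlgClosed F] [CharZero F] {f : F[X]}
    (hf : 2 ≤ f.natDegree) (T : Finset F) (hne : T.Nonempty) (hT : ∀ a, f.eval a ∈ T → a ∈ T) :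
    IsSpecialPolyAux f := by
  classical
  have hf0 : 0 < f.natDegree := by omega
  have hcard : T.card ≤ 1 := by
    set R : F[X] := ∏ q ∈ T, (X - C q) with hR
    have hR0 : R ≠ 0 := Finset.prod_ne_zero_iff.2 fun q _ => X_sub_C_ne_zero q
    have hRdeg : R.natDegree = T.card := by simp [hR]
    have hRm : ∀ b, R.rootMultiplicity b = if b ∈ T then 1 else 0 := by
      intro b
      rw [← count_roots, hR, roots_prod_X_sub_C]
      exact Multiset.count_eq_of_nodup T.nodup
    have h1 : ∑ a ∈ T, (R.comp f).rootMultiplicity a = f.natDegree * T.card := by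
      rw [sum_rootMultiplicity_eq, natDegree_comp, hRdeg, mul_comm]
      intro a ha
      rw [rootMultiplicity_comp hf0 hR0, hRm, if_neg (fun h => ha (hT a h)), mul_zero]
    have h2 : ∑ a ∈ T, (R.comp f).rootMultiplicity a ≤
        ∑ a ∈ T, (1 + f.derivative.rootMultiplicity a) := by
      refine Finset.sum_le_sum fun a _ => ?_
      rw [rootMultiplicity_comp hf0 hR0, hRm, rootMultiplicity_derivative_eq]
      have := ramification_pos hf0 a
      split_ifs <;> omega
    rw [Finset.sum_add_distrib, h1] at h2
    have h3 := sum_rootMultiplicity_le f.derivative T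
    have h4 := natDegree_derivative_lt (p := f) (by omega)
    simp only [Finset.sum_const, smul_eq_mul, mul_one] at h2
    obtain ⟨d, hd⟩ : ∃ d, f.natDegree = d + 2 := ⟨f.natDegree - 2, by omega⟩
    rw [hd] at h2 h4
    by_contra hc
    nlinarith
  obtain ⟨q, rfl⟩ := Finset.card_eq_one.1 (le_antisymm hcard hne.card_pos)
  have hroots : ∀ a, f.eval a = q → a = q := fun a h => by
    simpa using hT a (by simp [h])
  set l := f.leadingCoeff with hl
  have hl0 : l ≠ 0 := leadingCoeff_ne_zero.2 (by rintro rfl; simp at hf)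
  have hfq : f - C q = C l * (X - C q) ^ f.natDegree := by
    have hsp := IsAlgClosed.splits (f - C q)
    have hnd : (f - C q).natDegree = f.natDegree := natDegree_sub_C
    have h5 : (f - C q).roots = Multiset.replicate f.natDegree q := by
      rw [Multiset.eq_replicate, splits_iff_card_roots.1 hsp, hnd]
      refine ⟨rfl, fun a ha => hroots a ?_⟩
      have := (mem_roots'.1 ha).2
      simpa [IsRoot, sub_eq_zero] using this
    have h6 : (f - C q).leadingCoeff = l := by
      rw [hl, leadingCoeff, leadingCoeff, hnd, coeff_sub, coeff_C, if_neg (by omega), sub_zero]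
    conv_lhs => rw [hsp.eq_prod_roots, h5, h6]
    simp
  obtain ⟨a, ha⟩ := IsAlgClosed.exists_pow_nat_eq (l⁻¹) (n := f.natDegree - 1) (by omega)
  have ha0 : a ≠ 0 := by
    rintro rfl
    rw [zero_pow (by omega)] at ha
    exact inv_ne_zero hl0 ha.symm
  refine ⟨a, q, ha0, X ^ f.natDegree, Or.inl rfl, ?_⟩
  have hf' : f = C q + C l * (X - C q) ^ f.natDegree := by rw [← hfq]; ring
  have h7 : C l * C a ^ f.natDegree = C a := by
    rw [← C_pow, ← C_mul]
    congr 1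
    obtain ⟨d, hd⟩ : ∃ d, f.natDegree = d + 1 := ⟨f.natDegree - 1, by omega⟩
    rw [hd] at ha ⊢
    simp only [Nat.add_sub_cancel] at ha
    rw [pow_succ, ha, ← mul_assoc, mul_inv_cancel₀ hl0, one_mul]
  generalize f.natDegree = d at *
  conv_rhs => rw [hf']
  simp only [add_comp, mul_comp, C_comp, X_comp, sub_comp, pow_comp, add_sub_cancel_right]
  rw [mul_pow, ← mul_assoc, h7, add_comm]

theorem eq_zero_of_chebyshev_ode [CharZero F] (u : F[X]) (d : ℕ) (hd : u.natDegree < d)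
    (h : (1 - X ^ 2) * derivative (derivative u) = X * derivative u - (d : F[X]) ^ 2 * u) :
    u = 0 := by
  by_contra hu
  set k := u.natDegree with hk
  have hc : u.coeff k ≠ 0 := by simpa [hk] using hu
  have h1 := congrArg (fun p : F[X] => p.coeff k) h
  have h2 : ((d : F[X]) ^ 2 * u).coeff k = (d : F) ^ 2 * u.coeff k := by
    rw [← C_eq_natCast, ← C_pow, coeff_C_mul]
  have hz : u.coeff (k + 2) = 0 := coeff_eq_zero_of_natDegree_lt (by omega)
  have h3 : (X * derivative u).coeff k = k * u.coeff k := by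
    rcases k with _ | k
    · simp
    · rw [coeff_X_mul, coeff_derivative]; push_cast; ring
  have h4 : ((1 - X ^ 2) * derivative (derivative u)).coeff k = - (k * (k - 1)) * u.coeff k := by
    rw [sub_mul, one_mul, coeff_sub, coeff_derivative, coeff_derivative, hz]
    rcases k with _ | _ | k
    · simp
    · simp [coeff_X_pow_mul']
    · rw [coeff_X_pow_mul, coeff_derivative, coeff_derivative]; push_cast; ring
  simp only [coeff_sub, h2, h3] at h1
  rw [h4] at h1
  have h5 : ((d : F) ^ 2 - (k : F) ^ 2) * u.coeff k = 0 := by linear_combination h1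
  rcases mul_eq_zero.1 h5 with h6 | h6
  · have h7 : (d : F) ^ 2 = (k : F) ^ 2 := sub_eq_zero.1 h6
    have h8 : d ^ 2 = k ^ 2 := by exact_mod_cast h7
    have := Nat.pow_left_injective (n := 2) (by norm_num) h8
    omega
  · exact hc h6

theorem chebyshev_C_isChebyshevPoly (d : ℕ) :
    IsChebyshevPoly d (Polynomial.Chebyshev.C F d) := by
  intro x hx
  induction d using Nat.strong_induction_on with
  | _ d ih =>
    rcases d with _ | _ | d
    · simp; norm_num
    · simp
    · have h1 := ih (d + 1) (by omega)
      have h2 := ih d (by omega)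
      rw [Polynomial.Chebyshev.C_eq]
      have e1 : ((d + 1 + 1 : ℕ) : ℤ) - 1 = ((d + 1 : ℕ) : ℤ) := by push_cast; ring
      have e2 : ((d + 1 + 1 : ℕ) : ℤ) - 2 = ((d : ℕ) : ℤ) := by push_cast; ring
      rw [e1, e2, eval_sub, eval_mul, eval_X, h1, h2]
      have := mul_inv_cancel₀ hx
      generalize x⁻¹ = y at *
      linear_combination (x ^ d + y ^ d) * this

theorem eq_or_eq_neg_chebyshev_T [CharZero F] {h : F[X]} {d : ℕ} (hd : 1 ≤ d)
    (hdeg : h.natDegree = d)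
    (hode : derivative h ^ 2 * (X ^ 2 - 1) = (d : F[X]) ^ 2 * (h ^ 2 - 1)) :
    h = Polynomial.Chebyshev.T F d ∨ h = -Polynomial.Chebyshev.T F d := by
  have hh' : derivative h ≠ 0 := derivative_ne_zero_of_natDegree_pos (by omega)
  have hlin : (1 - X ^ 2) * derivative (derivative h) = X * derivative h - (d : F[X]) ^ 2 * h := by
    have := congrArg derivative hode
    simp only [derivative_mul, derivative_pow, derivative_sub, derivative_X, derivative_one,
      derivative_natCast, Nat.cast_ofNat, map_ofNat] at this
    have h2 : (2 : F[X]) * derivative h ≠ 0 := mul_ne_zero two_ne_zero hh'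
    apply mul_left_cancel₀ h2
    linear_combination -this
  set T := Polynomial.Chebyshev.T F d with hT
  have hTdeg : T.natDegree = d := by simp [hT]
  have hTlin : (1 - X ^ 2) * derivative (derivative T) =
      X * derivative T - (d : F[X]) ^ 2 * T := by
    have := Polynomial.Chebyshev.one_sub_X_sq_mul_derivative_derivative_T_eq_poly_in_T (R := F) d
    simpa [← hT] using this
  have hT0 : T ≠ 0 := by intro h0; rw [h0] at hTdeg; simp at hTdeg; omega
  set c := h.leadingCoeff / T.leadingCoeff with hc
  have hu : h - C c * T = 0 := by
    apply eq_zero_of_chebyshev_ode _ d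
    · have hle : (h - C c * T).natDegree ≤ d :=
        (natDegree_sub_le _ _).trans (max_le hdeg.le ((natDegree_C_mul_le _ _).trans hTdeg.le))
      refine lt_of_le_of_ne hle fun he => ?_
      have : (h - C c * T).coeff d = 0 := by
        rw [coeff_sub, coeff_C_mul]
        have e1 : h.coeff d = h.leadingCoeff := by rw [← hdeg]; rfl
        have e2 : T.coeff d = T.leadingCoeff := by
          conv_lhs => rw [← hTdeg]
          rfl
        rw [e1, e2, hc, div_mul_cancel₀ _ (leadingCoeff_ne_zero.2 hT0), sub_self]
      have h3 := leadingCoeff_eq_zero.1 (show (h - C c * T).leadingCoeff = 0 by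
        rw [leadingCoeff, he, this])
      rw [h3] at he
      simp at he
      omega
    · simp only [derivative_sub, derivative_C_mul]
      linear_combination hlin - C c * hTlin
  have hhT := sub_eq_zero.1 hu
  have hev := congrArg (eval 1) hode
  have hd0 : (d : F) ≠ 0 := by exact_mod_cast (by omega : d ≠ 0)
  rw [hhT] at hev
  simp [hT, hd0] at hev
  have hc2 : (c - 1) * (c + 1) = 0 := by linear_combination hev
  rcases mul_eq_zero.1 hc2 with h1 | h1
  · left; rw [hhT, sub_eq_zero.1 h1]; simp
  · right; rw [hhT, eq_neg_of_add_eq_zero_left h1]; simp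

end PolynomialLemmas

section FunctionalEquation

variable {F : Type} [Field F] [CharZero F]

theorem isSpecialPolyAux_of_derivative_sq_eq {f : F[X]} (hf : 2 ≤ f.natDegree) {q₁ q₂ : F}
    (hq : q₁ ≠ q₂)
    (h : derivative f ^ 2 * ((X - C q₁) * (X - C q₂)) =
      (f.natDegree : F[X]) ^ 2 * ((f - C q₁) * (f - C q₂))) :
    IsSpecialPolyAux f := by
  set d := f.natDegree with hd
  set a : F := (q₁ - q₂) / 2 with ha
  set b : F := (q₁ + q₂) / 2 with hb
  have ha0 : a ≠ 0 := div_ne_zero (sub_ne_zero.2 hq) two_ne_zero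
  have hq₁ : q₁ = b + a := by rw [ha, hb]; ring
  have hq₂ : q₂ = b - a := by rw [ha, hb]; ring
  set t : F[X] := C a⁻¹ * (f.comp (C a * X + C b) - C b) with ht
  have hCa : (C a : F[X]) * C a⁻¹ = 1 := by rw [← C_mul, mul_inv_cancel₀ ha0, C_1]
  have hft : f.comp (C a * X + C b) = C a * t + C b := by
    rw [ht]; linear_combination -(f.comp (C a * X + C b) - C b) * hCa
  have hdt : (derivative f).comp (C a * X + C b) = derivative t := by
    have := congrArg derivative hft
    rw [derivative_comp] at this
    simp only [derivative_add, derivative_mul, derivative_C, derivative_X, zero_mul, zero_add,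
      add_zero, mul_one] at this
    exact mul_left_cancel₀ (C_ne_zero.2 ha0) this
  have htdeg : t.natDegree = d := by
    rw [ht, natDegree_C_mul (inv_ne_zero ha0), natDegree_sub_C, natDegree_comp,
      natDegree_linear ha0, mul_one]
  have hode : derivative t ^ 2 * (X ^ 2 - 1) = (d : F[X]) ^ 2 * (t ^ 2 - 1) := by
    have h1 := congrArg (fun p : F[X] => p.comp (C a * X + C b)) h
    simp only [mul_comp, pow_comp, sub_comp, X_comp, C_comp, natCast_comp, hdt, hft] at h1
    rw [hq₁, hq₂, C_add, C_sub] at h1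
    have h2 : (C a ^ 2 : F[X]) ≠ 0 := pow_ne_zero _ (C_ne_zero.2 ha0)
    apply mul_left_cancel₀ h2
    linear_combination h1
  have hT := eq_or_eq_neg_chebyshev_T (by omega) htdeg hode
  have hinv : Invertible (2 : F) := invertibleOfNonzero two_ne_zero
  have hCT : Polynomial.Chebyshev.C F d =
      2 * (Polynomial.Chebyshev.T F d).comp (C ⅟2 * X) :=
    Polynomial.Chebyshev.C_eq_two_mul_T_comp_half_mul_X F d
  have hcancel : (C (a / 2) : F[X]) * 2 = C a := by
    rw [← C_ofNat, ← C_mul, div_mul_cancel₀ _ two_ne_zero]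
  have hcomp : f.comp (C (a / 2) * X + C b) = C a * t.comp (C ⅟2 * X) + C b := by
    have := congrArg (fun p : F[X] => p.comp (C ⅟2 * X)) hft
    simp only [comp_assoc, add_comp, mul_comp, C_comp, X_comp] at this
    rw [← this, ← mul_assoc, ← C_mul, invOf_eq_inv, div_eq_mul_inv]
  have key : ∀ e : F[X], e * e = 1 → t = e * Polynomial.Chebyshev.T F d → (e = 1 ∨ e = -1) →
      (C (a / 2) * X + C b).comp (e * Polynomial.Chebyshev.C F d) =
        f.comp (C (a / 2) * X + C b) := by
    intro e _ he h1
    rw [hcomp, he, hCT]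
    simp only [add_comp, mul_comp, C_comp, X_comp]
    rcases h1 with rfl | rfl
    · simp only [one_comp]; linear_combination
        (Polynomial.Chebyshev.T F d).comp (C ⅟2 * X) * hcancel
    · simp only [neg_comp, one_comp]; linear_combination
        -(Polynomial.Chebyshev.T F d).comp (C ⅟2 * X) * hcancel
  rcases hT with hT | hT
  · refine ⟨a / 2, b, div_ne_zero ha0 two_ne_zero, 1 * Polynomial.Chebyshev.C F d, ?_,
      key 1 (by ring) (by rw [hT]; ring) (Or.inl rfl)⟩
    rw [one_mul]
    exact Or.inr (Or.inl (chebyshev_C_isChebyshevPoly _))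
  · refine ⟨a / 2, b, div_ne_zero ha0 two_ne_zero, -1 * Polynomial.Chebyshev.C F d, ?_,
      key (-1) (by ring) (by rw [hT]; ring) (Or.inr rfl)⟩
    rw [neg_one_mul, neg_neg]
    exact Or.inr (Or.inr (chebyshev_C_isChebyshevPoly _))

theorem isSpecialPolyAux_of_half_orbifold [IsAlgClosed F] {f : F[X]} (hf : 2 ≤ f.natDegree) {q₁ q₂ : F}
    (hq : q₁ ≠ q₂)
    (h : ∀ a, 2 * ((f - C (f.eval a)).rootMultiplicity a - 1) +
        ((X - C q₁) * (X - C q₂)).rootMultiplicity a =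
      (f - C (f.eval a)).rootMultiplicity a *
        ((X - C q₁) * (X - C q₂)).rootMultiplicity (f.eval a)) :
    IsSpecialPolyAux f := by
  have hf0 : 0 < f.natDegree := by omega
  have hfne : f ≠ 0 := by rintro rfl; simp at hf
  have hd0 : (f.natDegree : F) ≠ 0 := by exact_mod_cast hf0.ne'
  have hR : (X - C q₁) * (X - C q₂) ≠ 0 := mul_ne_zero (X_sub_C_ne_zero _) (X_sub_C_ne_zero _)
  apply isSpecialPolyAux_of_derivative_sq_eq hf hq
  have hcomp : (f - C q₁) * (f - C q₂) = ((X - C q₁) * (X - C q₂)).comp f := by simp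
  rw [hcomp, ← C_eq_natCast, ← C_pow]
  apply eq_of_rootMultiplicity_eq
  · rw [leadingCoeff_mul, leadingCoeff_mul, leadingCoeff_pow, leadingCoeff_mul, leadingCoeff_C, leadingCoeff_comp
      hf0.ne', leadingCoeff_mul, leadingCoeff_X_sub_C, leadingCoeff_X_sub_C, natDegree_mul
      (X_sub_C_ne_zero _) (X_sub_C_ne_zero _), natDegree_X_sub_C, natDegree_X_sub_C]
    have : (derivative f).leadingCoeff = f.leadingCoeff * f.natDegree := by
      rw [leadingCoeff, natDegree_derivative, coeff_derivative]
      have : f.natDegree - 1 + 1 = f.natDegree := by omega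
      rw [this]
      congr 1
      exact_mod_cast this
    rw [this]; ring
  · intro a
    rw [rootMultiplicity_mul (mul_ne_zero (pow_ne_zero _ (derivative_ne_zero_of_natDegree_pos hf0))
      hR), rootMultiplicity_pow_eq, rootMultiplicity_derivative_eq, h,
      rootMultiplicity_mul (mul_ne_zero (C_ne_zero.2 (pow_ne_zero _ hd0))
      (comp_ne_zero_of_natDegree_pos hf0 hR)), rootMultiplicity_comp hf0 hR, rootMultiplicity_C,
      zero_add]

theorem isSpecialPolyAux_of_functional_equation [IsAlgClosed F] {f P Q : F[X]} (hf : 2 ≤ f.natDegree)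
    (hP : P ≠ 0) (hQ : Q ≠ 0) {r : ℕ} (hr : 1 ≤ r) {c : F} (hc : c ≠ 0)
    (h : P.comp f * Q * derivative f ^ r = C c * (P * Q.comp f)) :
    IsSpecialPolyAux f := by
  classical
  have hf0 : 0 < f.natDegree := by omega
  have hfne : f ≠ 0 := by rintro rfl; simp at hf
  have hf' := derivative_ne_zero_of_natDegree_pos hf0
  have hPf := comp_ne_zero_of_natDegree_pos hf0 hP
  have hQf := comp_ne_zero_of_natDegree_pos hf0 hQ
  set e : F → ℕ := fun a => (f - C (f.eval a)).rootMultiplicity a with he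
  have he1 : ∀ a, 1 ≤ e a := fun a => ramification_pos hf0 a
  set μ : F → ℤ := fun a => (P.rootMultiplicity a : ℤ) - Q.rootMultiplicity a + r with hμ
  have hμe : ∀ a, μ a = e a * μ (f.eval a) := by
    intro a
    have h1 := congrArg (rootMultiplicity a) h
    rw [rootMultiplicity_mul (mul_ne_zero (mul_ne_zero hPf hQ) (pow_ne_zero _ hf')),
      rootMultiplicity_mul (mul_ne_zero hPf hQ), rootMultiplicity_pow_eq,
      rootMultiplicity_derivative_eq, rootMultiplicity_comp hf0 hP,
      rootMultiplicity_mul (mul_ne_zero (C_ne_zero.2 hc) (mul_ne_zero hP hQf)),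
      rootMultiplicity_C, zero_add, rootMultiplicity_mul (mul_ne_zero hP hQf),
      rootMultiplicity_comp hf0 hQ] at h1
    change e a * _ + _ + r * (e a - 1) = _ + e a * _ at h1
    have h2 := he1 a
    zify [h2] at h1
    simp only [hμ]
    linear_combination -h1
  have hdeg : Q.natDegree = P.natDegree + r := by
    have h1 := congrArg natDegree h
    rw [natDegree_mul (mul_ne_zero hPf hQ) (pow_ne_zero _ hf'), natDegree_mul hPf hQ,
      natDegree_pow, natDegree_derivative, natDegree_comp, natDegree_C_mul hc,
      natDegree_mul hP hQf, natDegree_comp] at h1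
    obtain ⟨d, hd⟩ : ∃ d, f.natDegree = d + 2 := ⟨f.natDegree - 2, by omega⟩
    rw [hd] at h1
    have h2 : d + 2 - 1 = d + 1 := rfl
    rw [h2] at h1
    have h3 : (d + 1) * Q.natDegree = (d + 1) * (P.natDegree + r) := by nlinarith
    exact Nat.eq_of_mul_eq_mul_left (by omega) h3
  set Z : Finset F := (P * Q).roots.toFinset with hZ
  have hPQ : P * Q ≠ 0 := mul_ne_zero hP hQ
  have hZmem : ∀ a, μ a ≠ r → a ∈ Z := by
    intro a ha
    by_contra hn
    rw [hZ, Multiset.mem_toFinset, mem_roots hPQ, IsRoot, eval_mul, mul_eq_zero, not_or] at hn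
    apply ha
    simp only [hμ]
    rw [rootMultiplicity_eq_zero (p := P) hn.1, rootMultiplicity_eq_zero (p := Q) hn.2]
    simp
  have hZnot : ∀ a ∉ Z, P.rootMultiplicity a = 0 ∧ Q.rootMultiplicity a = 0 := by
    intro a hn
    rw [hZ, Multiset.mem_toFinset, mem_roots hPQ, IsRoot, eval_mul, mul_eq_zero, not_or] at hn
    exact ⟨rootMultiplicity_eq_zero hn.1, rootMultiplicity_eq_zero hn.2⟩
  have hsum : ∑ a ∈ Z, ((r : ℤ) - μ a) = r := by
    have h1 := sum_rootMultiplicity_eq (P := P) Z fun a ha => (hZnot a ha).1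
    have h2 := sum_rootMultiplicity_eq (P := Q) Z fun a ha => (hZnot a ha).2
    zify at h1 h2 hdeg
    have : ∀ a, (r : ℤ) - μ a = Q.rootMultiplicity a - P.rootMultiplicity a := fun a => by
      simp only [hμ]; ring
    simp only [this]
    rw [Finset.sum_sub_distrib, h1, h2, hdeg]; ring
  by_contra hns
  have hback : ∀ p : F → Prop, (∀ a, p a → μ a ≠ r) → (∀ a, p (f.eval a) → p a) → ∀ a, ¬ p a := by
    intro p hp1 hp2 a ha
    apply hns
    refine isSpecialPolyAux_of_finite_backward_invariant hf (Z.filter p)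
      ⟨a, by simp [hZmem a (hp1 a ha), ha]⟩ fun b hb => ?_
    have hb' := hp2 b (Finset.mem_filter.1 hb).2
    simp [hZmem b (hp1 b hb'), hb']
  have hr' : (1 : ℤ) ≤ r := by exact_mod_cast hr
  have hez : ∀ a, (1 : ℤ) ≤ e a := fun a => by exact_mod_cast he1 a
  have hpos : ∀ a, 0 < μ a := by
    intro a
    have := hback (fun a => μ a ≤ 0) (fun a ha => by omega) (fun a ha => by
      rw [hμe]; nlinarith [hez a]) a
    omega
  have hle : ∀ a, μ a ≤ r := by
    intro a
    have := hback (fun a => (r : ℤ) < μ a) (fun a ha => by omega) (fun a ha => by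
      rw [hμe]; nlinarith [hez a]) a
    omega
  have hhalf : ∀ a, μ a ≠ r → 2 * μ a ≤ r := by
    intro a ha
    have := hback (fun a => μ a < r ∧ (r : ℤ) < 2 * μ a) (fun a ha => by omega) (fun a ha => by
      have h1 := hμe a
      have h2 : (e a : ℤ) = 1 := by
        by_contra h3
        have h4 : (2 : ℤ) ≤ e a := by have := hez a; omega
        have h5 := hle a
        nlinarith
      rw [h2, one_mul] at h1
      rwa [h1]) a
    have := hle a
    grind
  set S := Z.filter fun a => μ a ≠ r with hS
  have hSmem : ∀ a, a ∈ S ↔ μ a ≠ r := fun a => by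
    simp only [hS, Finset.mem_filter, and_iff_right_iff_imp]; exact hZmem a
  have hsumS : ∑ a ∈ S, ((r : ℤ) - μ a) = r := by
    refine Eq.trans ?_ hsum
    rw [hS, Finset.sum_filter]
    refine Finset.sum_congr rfl fun a _ => ?_
    split_ifs with h1
    · rfl
    · push Not at h1; rw [h1]; ring
  have hcard : S.card = 2 := by
    have h1 : ∑ a ∈ S, (r : ℤ) ≤ ∑ a ∈ S, 2 * ((r : ℤ) - μ a) :=
      Finset.sum_le_sum fun a ha => by
        have := hhalf a ((hSmem a).1 ha)
        omega
    rw [← Finset.mul_sum, hsumS] at h1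
    simp only [Finset.sum_const, nsmul_eq_mul] at h1
    have h2 : (S.card : ℤ) ≤ 2 := by nlinarith
    have h3 : S.card ≤ 2 := by exact_mod_cast h2
    interval_cases hk : S.card
    · rw [Finset.card_eq_zero.1 hk] at hsumS
      simp at hsumS; omega
    · obtain ⟨q, hq⟩ := Finset.card_eq_one.1 hk
      rw [hq] at hsumS
      have := hpos q
      simp at hsumS; omega
    · rfl
  obtain ⟨q₁, q₂, hq, hSq⟩ := Finset.card_eq_two.1 hcard
  have hq1 := hhalf q₁ ((hSmem q₁).1 (by simp [hSq]))
  have hq2 := hhalf q₂ ((hSmem q₂).1 (by simp [hSq]))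
  rw [hSq, Finset.sum_pair hq] at hsumS
  have hmR : ∀ a, (((X - C q₁) * (X - C q₂)).rootMultiplicity a : ℤ) = if a ∈ S then 1 else 0 := by
    intro a
    rw [rootMultiplicity_mul (mul_ne_zero (X_sub_C_ne_zero _) (X_sub_C_ne_zero _)),
      rootMultiplicity_X_sub_C, rootMultiplicity_X_sub_C, hSq]
    by_cases h1 : a = q₁
    · subst h1; simp [hq]
    · by_cases h2 : a = q₂
      · subst h2; simp [h1]
      · simp [h1, h2]
  have hμR : ∀ a, 2 * μ a = r * (2 - (((X - C q₁) * (X - C q₂)).rootMultiplicity a : ℤ)) := by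
    intro a
    rw [hmR]
    split_ifs with h1
    · rw [hSq] at h1
      simp only [Finset.mem_insert, Finset.mem_singleton] at h1
      rcases h1 with rfl | rfl <;> omega
    · rw [hSmem] at h1
      push Not at h1
      rw [h1]; ring
  apply hns
  apply isSpecialPolyAux_of_half_orbifold hf hq
  intro a
  change 2 * (e a - 1) + _ = e a * _
  have h1 := hμe a
  have h2 := hμR a
  have h3 := hμR (f.eval a)
  have h4 := he1 a
  zify [h4]
  have h5 : (r : ℤ) ≠ 0 := by omega
  apply mul_left_cancel₀ h5
  linear_combination (-2 : ℤ) * h1 + h2 - (e a : ℤ) * h3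

end FunctionalEquation

section Descent

theorem iterate_comp_succ {F : Type} [Field F] (f : F[X]) (j : ℕ) :
    (f.comp^[j + 1] X) = (f.comp^[j] X).comp f := by
  induction j with
  | zero => simp
  | succ j ih =>
    rw [Function.iterate_succ_apply', ih, ← comp_assoc, ← Function.iterate_succ_apply' f.comp, ih]

theorem isSpecialPolyAux_of_iterate_functional_equation {F : Type} [Field F] [CharZero F]
    [IsAlgClosed F] {f P Q : F[X]} (hf : 2 ≤ f.natDegree)
    (hP : P ≠ 0) (hQ : Q ≠ 0) {r m : ℕ} (hr : 1 ≤ r) (hm : 1 ≤ m) {c : F} (hc : c ≠ 0)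
    (h : P.comp (f.comp^[m] X) * Q * derivative (f.comp^[m] X) ^ r =
      C c * (P * Q.comp (f.comp^[m] X))) :
    IsSpecialPolyAux f := by
  have hdeg : ∀ j, 0 < (f.comp^[j] X).natDegree := by
    intro j
    rw [natDegree_iterate_comp, natDegree_X, mul_one]
    exact pow_pos (by omega) _
  set A : ℕ → F[X] := fun j => P.comp (f.comp^[j] X) * derivative (f.comp^[j] X) ^ r with hA
  set B : ℕ → F[X] := fun j => Q.comp (f.comp^[j] X) with hB
  have hA0 : ∀ j, A j ≠ 0 := fun j => mul_ne_zero (comp_ne_zero_of_natDegree_pos (hdeg j) hP)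
    (pow_ne_zero _ (derivative_ne_zero_of_natDegree_pos (hdeg j)))
  have hB0 : ∀ j, B j ≠ 0 := fun j => comp_ne_zero_of_natDegree_pos (hdeg j) hQ
  have hAs : ∀ j, (A j).comp f * derivative f ^ r = A (j + 1) := by
    intro j
    simp only [hA]
    rw [iterate_comp_succ, derivative_comp, mul_comp, pow_comp, comp_assoc]
    ring
  have hBs : ∀ j, (B j).comp f = B (j + 1) := by
    intro j
    simp only [hB]
    rw [iterate_comp_succ, comp_assoc]
  have hA00 : A 0 = P := by simp [hA]
  have hB00 : B 0 = Q := by simp [hB]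
  have hN : (∏ j ∈ Finset.range m, A j).comp f * derivative f ^ (r * m) * P =
      (∏ j ∈ Finset.range m, A j) * A m := by
    rw [prod_comp, pow_mul, ← Finset.card_range m, ← Finset.prod_const, Finset.card_range,
      ← Finset.prod_mul_distrib, ← Finset.prod_range_succ, Finset.prod_range_succ', hA00]
    simp only [hAs]
  have hM : (∏ j ∈ Finset.range m, B j).comp f * Q = (∏ j ∈ Finset.range m, B j) * B m := by
    rw [prod_comp, ← Finset.prod_range_succ, Finset.prod_range_succ', hB00]
    simp only [hBs]
  have hm' : A m * Q = C c * (P * B m) := by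
    simp only [hA, hB]
    rw [← h]; ring
  refine isSpecialPolyAux_of_functional_equation hf (P := ∏ j ∈ Finset.range m, A j)
    (Q := ∏ j ∈ Finset.range m, B j) (Finset.prod_ne_zero_iff.2 fun j _ => hA0 j)
    (Finset.prod_ne_zero_iff.2 fun j _ => hB0 j) (r := r * m) (by nlinarith) hc ?_
  apply mul_left_cancel₀ (mul_ne_zero hP hQ)
  linear_combination (∏ j ∈ Finset.range m, B j) * Q * hN +
    (∏ j ∈ Finset.range m, A j) * (∏ j ∈ Finset.range m, B j) * hm' -
    C c * P * (∏ j ∈ Finset.range m, A j) * hM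

variable {F k : Type} [Field F] [Field k] [Algebra F k]

theorem exists_eq_map_mul_of_ne_zero (P : k[X]) (hP : P ≠ 0) :
    ∃ (P₀ : F[X]) (P₁ : k[X]), P₀ ≠ 0 ∧ P = P₀.map (algebraMap F k) * P₁ ∧
      ∀ a : F, P₁.eval (algebraMap F k a) ≠ 0 := by
  induction hn : P.natDegree using Nat.strong_induction_on generalizing P with
  | _ n ih =>
    by_cases h : ∃ a : F, P.eval (algebraMap F k a) = 0
    · obtain ⟨a, ha⟩ := h
      obtain ⟨R, rfl⟩ := dvd_iff_isRoot.2 (show P.IsRoot (algebraMap F k a) from ha)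
      have hR : R ≠ 0 := right_ne_zero_of_mul hP
      rw [natDegree_mul (X_sub_C_ne_zero _) hR, natDegree_X_sub_C] at hn
      obtain ⟨P₀, P₁, h0, h1, h2⟩ := ih R.natDegree (by omega) R hR rfl
      refine ⟨(X - C a) * P₀, P₁, mul_ne_zero (X_sub_C_ne_zero _) h0, ?_, h2⟩
      conv_lhs => rw [h1]
      simp [mul_assoc]
    · push Not at h
      exact ⟨1, P, one_ne_zero, by simp, h⟩

theorem isCoprime_map_of_eval_ne_zero [IsAlgClosed F] {R : k[X]} (hR : ∀ a : F, R.eval (algebraMap F k a) ≠ 0)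
    {S : F[X]} (hS : S ≠ 0) : IsCoprime R (S.map (algebraMap F k)) := by
  rw [(IsAlgClosed.splits S).eq_prod_roots, Polynomial.map_mul, map_C]
  have hu : IsUnit (C (algebraMap F k S.leadingCoeff)) := by
    rw [isUnit_C, isUnit_iff_ne_zero, _root_.map_ne_zero]
    exact leadingCoeff_ne_zero.2 hS
  rw [isCoprime_mul_unit_left_right hu]
  generalize S.roots = s
  induction s using Multiset.induction with
  | empty => simp [isCoprime_one_right]
  | cons a s ih =>
    rw [Multiset.map_cons, Multiset.prod_cons, Polynomial.map_mul]
    refine IsCoprime.mul_right ?_ ih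
    rw [Polynomial.map_sub, map_X, map_C]
    apply IsCoprime.symm
    rw [Irreducible.coprime_iff_not_dvd (irreducible_X_sub_C _), dvd_iff_isRoot]
    exact hR a

theorem exists_functional_equation_of_twisted [IsAlgClosed F] (σ : k →ₐ[F] k) {g : F[X]}
    (hg : 2 ≤ g.natDegree) (hg' : derivative g ≠ 0) {P Q : k[X]} (hP : P ≠ 0) (hQ : Q ≠ 0)
    {r : ℕ} {b : k} (hb : b ≠ 0)
    (h : (P.map (σ : k →+* k)).comp (g.map (algebraMap F k)) * Q *
        derivative (g.map (algebraMap F k)) ^ r =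
      C b * (P * (Q.map (σ : k →+* k)).comp (g.map (algebraMap F k)))) :
    ∃ (P₀ Q₀ : F[X]) (c : F), P₀ ≠ 0 ∧ Q₀ ≠ 0 ∧ c ≠ 0 ∧
      P₀.comp g * Q₀ * derivative g ^ r = C c * (P₀ * Q₀.comp g) := by
  set gk := g.map (algebraMap F k) with hgk
  have hgkdeg : gk.natDegree = g.natDegree := natDegree_map _
  have hgk0 : 0 < gk.natDegree := by omega
  set τ : k[X] →+* k[X] := (compRingHom gk).comp (mapRingHom (σ : k →+* k)) with hτ
  have hτa : ∀ p, τ p = (p.map (σ : k →+* k)).comp gk := fun p => rfl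
  have hτ0 : ∀ p, p ≠ 0 → τ p ≠ 0 := fun p hp =>
    comp_ne_zero_of_natDegree_pos hgk0 ((Polynomial.map_ne_zero_iff σ.injective).2 hp)
  have hτdeg : ∀ p, (τ p).natDegree = p.natDegree * g.natDegree := fun p => by
    rw [hτa, natDegree_comp, natDegree_map, hgkdeg]
  have hτF : ∀ p : F[X], τ (p.map (algebraMap F k)) = (p.comp g).map (algebraMap F k) := fun p => by
    rw [hτa, Polynomial.map_map, hgk, Polynomial.map_comp]
    congr 2
    ext a
    simp
  have hτroot : ∀ p : k[X], (∀ a : F, p.eval (algebraMap F k a) ≠ 0) →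
      ∀ a : F, (τ p).eval (algebraMap F k a) ≠ 0 := by
    intro p hp a h0
    rw [hτa, eval_comp, hgk, eval_map_algebraMap, aeval_algebraMap_apply] at h0
    have h1 : algebraMap F k (aeval a g) = (σ : k →+* k) (algebraMap F k (aeval a g)) := by simp
    rw [h1, eval_map, eval₂_hom, map_eq_zero] at h0
    exact hp _ h0
  rw [← hτa, ← hτa] at h
  classical
  set D := EuclideanDomain.gcd P Q with hD
  have hD0 : D ≠ 0 := fun h0 => hP (EuclideanDomain.gcd_eq_zero_iff.1 h0).1
  obtain ⟨P', hP'⟩ : ∃ P', P = D * P' := EuclideanDomain.gcd_dvd_left P Q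
  obtain ⟨Q', hQ'⟩ : ∃ Q', Q = D * Q' := EuclideanDomain.gcd_dvd_right P Q
  have hcop : IsCoprime P' Q' := by
    refine ⟨EuclideanDomain.gcdA P Q, EuclideanDomain.gcdB P Q, mul_left_cancel₀ hD0 ?_⟩
    have := EuclideanDomain.gcd_eq_gcd_ab P Q
    rw [← hD] at this
    linear_combination -this - EuclideanDomain.gcdA P Q * hP' - EuclideanDomain.gcdB P Q * hQ'
  have hP'0 : P' ≠ 0 := by rintro rfl; simp at hP'; exact hP hP'
  have hQ'0 : Q' ≠ 0 := by rintro rfl; simp at hQ'; exact hQ hQ'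
  have h' : τ P' * Q' * derivative gk ^ r = C b * (P' * τ Q') := by
    rw [hP', hQ', map_mul, map_mul] at h
    apply mul_left_cancel₀ (mul_ne_zero hD0 (hτ0 D hD0))
    linear_combination h
  obtain ⟨P₀, P₁, hP₀, hPe, hP₁⟩ := exists_eq_map_mul_of_ne_zero (F := F) P' hP'0
  obtain ⟨Q₀, Q₁, hQ₀, hQe, hQ₁⟩ := exists_eq_map_mul_of_ne_zero (F := F) Q' hQ'0
  have hcop1 : IsCoprime P₁ Q₁ := by
    rw [hPe, hQe] at hcop
    exact hcop.of_mul_left_right.of_mul_right_right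
  have hP₁0 : P₁ ≠ 0 := by rintro rfl; exact hP₁ 0 (by simp)
  have hQ₁0 : Q₁ ≠ 0 := by rintro rfl; exact hQ₁ 0 (by simp)
  have hgder : derivative gk = (derivative g).map (algebraMap F k) := by
    rw [hgk, derivative_map]
  have hg0 : 0 < g.natDegree := by omega
  rw [hPe, hQe, map_mul, map_mul, hτF, hτF, hgder] at h'
  set A : F[X] := P₀.comp g * Q₀ * derivative g ^ r with hA
  set B : F[X] := P₀ * Q₀.comp g with hB
  have hA0 : A ≠ 0 := mul_ne_zero (mul_ne_zero (comp_ne_zero_of_natDegree_pos hg0 hP₀) hQ₀)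
    (pow_ne_zero _ hg')
  have hB0 : B ≠ 0 := mul_ne_zero hP₀ (comp_ne_zero_of_natDegree_pos hg0 hQ₀)
  have h2 : τ P₁ * Q₁ * A.map (algebraMap F k) = C b * (P₁ * τ Q₁ * B.map (algebraMap F k)) := by
    simp only [hA, hB, Polynomial.map_mul, Polynomial.map_pow]
    linear_combination h'
  have hcopτ : IsCoprime (τ P₁) (τ Q₁) := hcop1.map τ
  have hb' : IsCoprime (τ P₁) (C b) := by
    refine ⟨0, C b⁻¹, ?_⟩
    rw [zero_mul, zero_add, ← C_mul, inv_mul_cancel₀ hb, C_1]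
  have hd1 : τ P₁ ∣ P₁ := by
    have : τ P₁ ∣ P₁ * (C b * τ Q₁ * B.map (algebraMap F k)) :=
      ⟨Q₁ * A.map (algebraMap F k), by linear_combination -h2⟩
    exact ((hb'.mul_right hcopτ).mul_right
      (isCoprime_map_of_eval_ne_zero (hτroot P₁ hP₁) hB0)).dvd_of_dvd_mul_right this
  have hd2 : τ Q₁ ∣ Q₁ := by
    have : τ Q₁ ∣ Q₁ * (τ P₁ * A.map (algebraMap F k)) :=
      ⟨C b * P₁ * B.map (algebraMap F k), by linear_combination h2⟩
    exact (hcopτ.symm.mul_right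
      (isCoprime_map_of_eval_ne_zero (hτroot Q₁ hQ₁) hA0)).dvd_of_dvd_mul_right this
  have hz : ∀ p : k[X], p ≠ 0 → τ p ∣ p → ∃ u, u ≠ 0 ∧ p = C u := by
    intro p hp hdvd
    have := natDegree_le_of_dvd hdvd hp
    rw [hτdeg] at this
    have hp0 : p.natDegree = 0 := by nlinarith
    obtain ⟨u, rfl⟩ := natDegree_eq_zero.1 hp0
    exact ⟨u, fun hu => hp (by rw [hu, C_0]), rfl⟩
  obtain ⟨u, hu, rfl⟩ := hz P₁ hP₁0 hd1
  obtain ⟨v, hv, rfl⟩ := hz Q₁ hQ₁0 hd2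
  have hτC : ∀ w : k, τ (C w) = C (σ w) := fun w => by rw [hτa, map_C, C_comp]; rfl
  rw [hτC, hτC] at h2
  set κ : k := b * u * σ v / (σ u * v) with hκ
  have huv : σ u * v ≠ 0 := mul_ne_zero ((_root_.map_ne_zero σ).2 hu) hv
  have h3 : A.map (algebraMap F k) = C κ * B.map (algebraMap F k) := by
    apply mul_left_cancel₀ (C_ne_zero.2 huv)
    rw [← mul_assoc, ← C_mul, hκ, mul_div_cancel₀ _ huv]
    simp only [C_mul]
    linear_combination h2
  have h4 := congrArg leadingCoeff h3
  rw [leadingCoeff_mul, leadingCoeff_C, leadingCoeff_map, leadingCoeff_map] at h4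
  have hBl := leadingCoeff_ne_zero.2 hB0
  have hBl' : algebraMap F k B.leadingCoeff ≠ 0 := (_root_.map_ne_zero _).2 hBl
  refine ⟨P₀, Q₀, A.leadingCoeff / B.leadingCoeff, hP₀, hQ₀,
    div_ne_zero (leadingCoeff_ne_zero.2 hA0) hBl, ?_⟩
  apply Polynomial.map_injective (algebraMap F k) (algebraMap F k).injective
  have h5 : algebraMap F k (A.leadingCoeff / B.leadingCoeff) = κ := by
    rw [map_div₀, h4, mul_div_cancel_right₀ _ hBl']
  rw [h3, ← hB, Polynomial.map_mul (p := C _), map_C, h5]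

end Descent

open scoped IntermediateField.algebraAdjoinAdjoin in
/-- In characteristic zero, every element transcendental over `K` admits a `K`-derivation taking
the value `1` on it. -/
theorem exists_derivation_apply_eq_one {K Ω : Type*} [Field K] [Field Ω] [Algebra K Ω]
    [CharZero K] {t : Ω} (ht : Transcendental K t) : ∃ D : Derivation K Ω Ω, D t = 1 := by
  have hind : AlgebraicIndepOn K id ({t} : Set Ω) := by
    have : AlgebraicIndependent K (fun i : ({t} : Set Ω) => (i : Ω)) := by
      have h1 : (fun i : ({t} : Set Ω) => (i : Ω)) = fun _ => t := by
        ext i; exact i.2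
      rw [h1]
      exact algebraicIndependent_unique_type_iff.mpr ht
    exact this
  obtain ⟨s, hts, hs⟩ := exists_isTranscendenceBasis_superset hind
  have hts' : t ∈ s := hts rfl
  let S := Algebra.adjoin K (Set.range ((↑) : s → Ω))
  let E := IntermediateField.adjoin K (Set.range ((↑) : s → Ω))
  have : Algebra.FormallyEtale S E := by
    exact .of_isLocalization (nonZeroDivisors _)
  have : Algebra.IsAlgebraic E Ω := hs.isAlgebraic_field
  have : Algebra.FormallyEtale E Ω := Algebra.FormallyEtale.of_isSeparable _ _
  have : Algebra.FormallyEtale S Ω := .comp _ E _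
  let e := hs.1.aevalEquiv
  let d : Derivation K S Ω := Derivation.mk'
    ((MvPolynomial.aeval ((↑) : s → Ω)).toLinearMap ∘ₗ
      (MvPolynomial.pderiv (R := K) (⟨t, hts'⟩ : s)).toLinearMap ∘ₗ e.symm.toLinearMap) (by
      intro a b
      have ha : ∀ a : S, MvPolynomial.aeval ((↑) : s → Ω) (e.symm a) = (a : Ω) := by
        intro a
        conv_rhs => rw [← e.apply_symm_apply a]
        rw [← hs.1.algebraMap_aevalEquiv]; rfl
      simp [Algebra.smul_def, ha])
  have hd : d ⟨t, Algebra.subset_adjoin ⟨⟨t, hts'⟩, rfl⟩⟩ = 1 := by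
    have : e.symm ⟨t, Algebra.subset_adjoin ⟨⟨t, hts'⟩, rfl⟩⟩ = MvPolynomial.X ⟨t, hts'⟩ := by
      rw [AlgEquiv.symm_apply_eq]
      ext
      have := hs.1.algebraMap_aevalEquiv (MvPolynomial.X ⟨t, hts'⟩)
      rw [MvPolynomial.aeval_X] at this
      exact this.symm
    change MvPolynomial.aeval _ (MvPolynomial.pderiv _ (e.symm _)) = _
    rw [this]; simp
  let φ : TensorProduct S Ω (Ω[S⁄K]) →ₗ[Ω] Ω :=
    TensorProduct.AlgebraTensorModule.lift
      (((LinearMap.ringLmapEquivSelf Ω Ω (Ω[S⁄K] →ₗ[S] Ω)).symm d.liftKaehlerDifferential))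
  let ψ := φ ∘ₗ (KaehlerDifferential.tensorKaehlerEquivOfFormallyEtale K S Ω).symm.toLinearMap
  refine ⟨ψ.compDer (KaehlerDifferential.D K Ω), ?_⟩
  have h2 := KaehlerDifferential.tensorKaehlerEquivOfFormallyEtale_symm_D_algebraMap K S Ω
    ⟨t, Algebra.subset_adjoin ⟨⟨t, hts'⟩, rfl⟩⟩
  change φ ((KaehlerDifferential.tensorKaehlerEquivOfFormallyEtale K S Ω).symm
    (KaehlerDifferential.D K Ω t)) = 1
  rw [show t = algebraMap S Ω ⟨t, Algebra.subset_adjoin ⟨⟨t, hts'⟩, rfl⟩⟩ from rfl, h2]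
  simp [φ, hd]

/-- The chain rule for an additive map that is a derivation along a ring homomorphism and kills
the coefficients. -/
theorem twisted_derivation_aeval {K Ω Ω' : Type*} [Field K] [Field Ω] [Field Ω'] [Algebra K Ω]
    (σ : Ω →+* Ω') (E : Ω →+ Ω') (hE : ∀ z w, E (z * w) = σ z * E w + σ w * E z)
    (hK : ∀ a : K, E (algebraMap K Ω a) = 0) (z : Ω) (p : K[X]) :
    E (aeval z p) = σ (aeval z (derivative p)) * E z := by
  induction p using Polynomial.induction_on with
  | C a => simp [hK]
  | add p q hp hq => simp only [_root_.map_add, hp, hq, add_mul]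
  | monomial n a h =>
    have h1 : (C a * X ^ (n + 1) : K[X]) = (C a * X ^ n) * X := by ring
    rw [h1, map_mul, hE, h, aeval_X, derivative_mul]
    simp
    ring

/-- A twisted derivation that kills `K` and `x` kills everything algebraic over `K(x)`. -/
theorem twisted_derivation_eq_zero {K Ω Ω' : Type*} [Field K] [Field Ω] [Field Ω'] [CharZero K]
    [Algebra K Ω]
    (σ : Ω →+* Ω') (E : Ω →+ Ω') (hE : ∀ z w, E (z * w) = σ z * E w + σ w * E z)
    (hK : ∀ a : K, E (algebraMap K Ω a) = 0) {x : Ω} (hx : E x = 0)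
    {z : Ω} (hz : IsAlgebraic (IntermediateField.adjoin K {x}) z) : E z = 0 := by
  have hM : ∀ a : IntermediateField.adjoin K {x}, E (algebraMap _ Ω a) = 0 := by
    rintro ⟨a, ha⟩
    change E a = 0
    induction ha using IntermediateField.adjoin_induction with
    | mem y hy => rw [Set.mem_singleton_iff.mp hy, hx]
    | algebraMap y => exact hK y
    | add a b _ _ ha hb => rw [_root_.map_add, ha, hb, add_zero]
    | inv a _ ha =>
      by_cases h0 : a = 0
      · simp [h0]
      have h1 := hE a a⁻¹
      rw [mul_inv_cancel₀ h0, ha, mul_zero, add_zero] at h1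
      have h2 : E 1 = 0 := by simpa using hK 1
      rw [h2] at h1
      exact (mul_eq_zero.mp h1.symm).resolve_left ((_root_.map_ne_zero σ).mpr h0)
    | mul a b _ _ ha hb => rw [hE, ha, hb]; simp
  have hint := hz.isIntegral
  have h1 := twisted_derivation_aeval σ E hE hM z (minpoly _ z)
  rw [minpoly.aeval, _root_.map_zero] at h1
  refine (mul_eq_zero.mp h1.symm).resolve_left ((_root_.map_ne_zero σ).mpr ?_)
  exact (minpoly.irreducible hint).separable.aeval_derivative_ne_zero (minpoly.aeval _ z)

/-- The constant coefficient of the minimal polynomial of `τ` when an endomorphism `σ` multiplies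
`τ` by an element `u` of the base field. -/
theorem coeff_zero_minpoly_of_scaled {M Ω : Type*} [Field M] [Field Ω] [Algebra M Ω]
    (σ : Ω →+* Ω) (σM : M →+* M) (hσ : ∀ a, algebraMap M Ω (σM a) = σ (algebraMap M Ω a))
    {τ : Ω} (hτ : IsIntegral M τ) {u : M} (hu : u ≠ 0) (h : σ τ = algebraMap M Ω u * τ) :
    σM ((minpoly M τ).coeff 0) = u ^ (minpoly M τ).natDegree * (minpoly M τ).coeff 0 := by
  set q := minpoly M τ with hq
  have hcomp : (algebraMap M Ω).comp σM = σ.comp (algebraMap M Ω) := RingHom.ext hσ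
  have h1 : aeval (σ τ) (q.map σM) = 0 := by
    rw [aeval_def, eval₂_map, hcomp, ← hom_eval₂, ← aeval_def, hq, minpoly.aeval, _root_.map_zero]
  have h2 : aeval τ ((q.map σM).scaleRoots u⁻¹) = 0 := by
    have := scaleRoots_aeval_eq_zero (r := u⁻¹) h1
    rwa [h, ← mul_assoc, ← map_mul, inv_mul_cancel₀ hu, _root_.map_one, one_mul] at this
  have hmon : (q.map σM).Monic := (minpoly.monic hτ).map σM
  have h3 : (q.map σM).scaleRoots u⁻¹ = q := by
    refine minpoly.unique M τ ((monic_scaleRoots_iff _).mpr hmon) h2 fun p hp hp0 => ?_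
    rw [degree_scaleRoots, degree_map]
    exact minpoly.min M τ hp hp0
  have h4 := congrArg (fun p => coeff p 0) h3
  simp only [coeff_scaleRoots, coeff_map, natDegree_map, Nat.sub_zero] at h4
  rw [inv_pow, ← div_eq_mul_inv, div_eq_iff (pow_ne_zero _ hu)] at h4
  rw [h4, mul_comm]

/-- An endomorphism `σ` acting on two elements `x₁, x₂` by the polynomial `g`: if `x₂` lies in a
`σ`-stable subfield `K` over which `x₁` is transcendental, while `x₁` and `x₂` generate the whole
field up to algebraic elements over a second `σ`-stable subfield `K₀`, then `g` satisfies a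
functional equation. -/
theorem exists_functional_equation_of_endomorphism {F Ω : Type} [Field F] [Field Ω] [Algebra F Ω]
    [IsAlgClosed F] [CharZero F] (σ : Ω →ₐ[F] Ω) {g : F[X]} (hg : 2 ≤ g.natDegree)
    {x₁ x₂ : Ω} (h₁ : σ x₁ = aeval x₁ g) (h₂ : σ x₂ = aeval x₂ g)
    (K₀ K : IntermediateField F Ω) (hK₀ : ∀ a ∈ K₀, σ a ∈ K₀) (hK : ∀ a ∈ K, σ a ∈ K)
    (ht₀ : Transcendental K₀ x₁) (ht : Transcendental K x₁) (hx₂ : x₂ ∈ K)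
    (ha₁ : ∀ z : Ω, IsAlgebraic (IntermediateField.adjoin K₀ {x₁}) z)
    (ha₂ : ∀ z : Ω, IsAlgebraic (IntermediateField.adjoin K₀ {x₂}) z)
    (ha : ∀ z : Ω, IsAlgebraic (IntermediateField.adjoin K {x₁}) z) :
    ∃ (r : ℕ) (P Q : F[X]) (c : F), 1 ≤ r ∧ P ≠ 0 ∧ Q ≠ 0 ∧ c ≠ 0 ∧
      P.comp g * Q * derivative g ^ r = C c * (P * Q.comp g) := by
  have : CharZero Ω := charZero_of_injective_algebraMap (algebraMap F Ω).injective
  obtain ⟨D, hD⟩ := exists_derivation_apply_eq_one ht₀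
  set τ := D x₂ with hτdef
  have hDF : ∀ (p : F[X]) (z : Ω), D (aeval z p) = aeval z (derivative p) * D z := by
    intro p z
    exact twisted_derivation_aeval (RingHom.id Ω) (D : Ω →+ Ω) (fun z w => by simp)
      (fun a : F => by
        have := D.map_algebraMap (algebraMap F K₀ a)
        rwa [← IsScalarTower.algebraMap_apply] at this) z p
  have hτ : τ ≠ 0 := by
    intro h0
    have := twisted_derivation_eq_zero (RingHom.id Ω) (D : Ω →+ Ω) (fun z w => by simp)
      (fun a : K₀ => D.map_algebraMap a) (x := x₂) h0 (ha₂ x₁)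
    exact one_ne_zero (hD.symm.trans this)
  have hg' : derivative g ≠ 0 := derivative_ne_zero_of_natDegree_pos (show 0 < g.natDegree by omega)
  have hgx₁ : aeval x₁ (derivative g) ≠ 0 := by
    intro h0
    refine ht₀ (IsAlgebraic.tower_top (K := F) K₀ ⟨derivative g, hg', h0⟩)
  have key : σ τ * aeval x₁ (derivative g) = aeval x₂ (derivative g) * τ := by
    let E : Ω →+ Ω :=
      { toFun := fun z => σ (D z) * aeval x₁ (derivative g) - D (σ z)
        map_zero' := by simp
        map_add' := fun a b => by simp only [_root_.map_add]; ring }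
    have hE0 : E x₂ = 0 := by
      refine twisted_derivation_eq_zero (K := K₀) (σ : Ω →+* Ω) E (fun z w => ?_) (fun a => ?_)
        (x := x₁) ?_ (ha₁ x₂)
      · change σ (D (z * w)) * aeval x₁ (derivative g) - D (σ (z * w)) =
          σ z * (σ (D w) * aeval x₁ (derivative g) - D (σ w)) +
          σ w * (σ (D z) * aeval x₁ (derivative g) - D (σ z))
        simp only [map_mul, Derivation.leibniz, smul_eq_mul, _root_.map_add]
        ring
      · change σ (D (algebraMap K₀ Ω a)) * aeval x₁ (derivative g) - D (σ (a : Ω)) = 0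
        have h3 : D (σ (a : Ω)) = 0 := D.map_algebraMap (⟨σ a, hK₀ a a.2⟩ : K₀)
        rw [D.map_algebraMap, h3]
        simp
      · change σ (D x₁) * aeval x₁ (derivative g) - D (σ x₁) = 0
        rw [h₁, hDF, hD]; simp
    have h3 : σ (D x₂) * aeval x₁ (derivative g) - D (σ x₂) = 0 := hE0
    rw [h₂, hDF] at h3
    exact sub_eq_zero.mp h3
  have hgx₂ : aeval x₂ (derivative g) ≠ 0 := by
    intro h0
    rw [h0, zero_mul] at key
    exact (mul_ne_zero ((_root_.map_ne_zero σ).mpr hτ) hgx₁) key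
  let M := IntermediateField.adjoin K {x₁}
  have hx₁M : x₁ ∈ M := IntermediateField.mem_adjoin_simple_self K x₁
  have hKM : ∀ a ∈ K, a ∈ M := fun a ha => M.algebraMap_mem (⟨a, ha⟩ : K)
  have haevM : ∀ (p : F[X]) (z : Ω), z ∈ M → aeval z p ∈ M := fun p z hz => by
    have h3 := aeval_algebraMap_apply Ω (⟨z, hz⟩ : M.restrictScalars F) p
    have h4 := (aeval (⟨z, hz⟩ : M.restrictScalars F) p).2
    exact (show aeval z p = _ from h3) ▸ h4
  have hσM : ∀ a ∈ M, σ a ∈ M := by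
    intro a ha
    induction ha using IntermediateField.adjoin_induction with
    | mem y hy => rw [Set.mem_singleton_iff.mp hy, h₁]; exact haevM _ _ hx₁M
    | algebraMap y => exact hKM _ (hK y y.2)
    | add a b _ _ ha hb => rw [_root_.map_add]; exact add_mem ha hb
    | inv a _ ha => rw [_root_.map_inv₀]; exact inv_mem ha
    | mul a b _ _ ha hb => rw [map_mul]; exact mul_mem ha hb
  let σM : M →+* M :=
    ((σ : Ω →+* Ω).comp (algebraMap M Ω)).codRestrict M.toSubfield (fun a => hσM a a.2)
  let u : M := ⟨aeval x₂ (derivative g) / aeval x₁ (derivative g),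
    div_mem (haevM _ _ (hKM _ hx₂)) (haevM _ _ hx₁M)⟩
  have hu : u ≠ 0 := by
    intro h0
    exact (div_ne_zero hgx₂ hgx₁) (congrArg Subtype.val h0)
  have hint : IsIntegral M τ := (ha τ).isIntegral
  have hc := coeff_zero_minpoly_of_scaled (σ : Ω →+* Ω) σM (fun a => rfl) hint hu (by
    change σ τ = (aeval x₂ (derivative g) / aeval x₁ (derivative g)) * τ
    field_simp
    exact key)
  set r := (minpoly M τ).natDegree with hr
  set c := (minpoly M τ).coeff 0 with hcdef
  have hc0 : c ≠ 0 := minpoly.coeff_zero_ne_zero hint hτ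
  obtain ⟨P, Q, hPQ⟩ := (IntermediateField.mem_adjoin_simple_iff K (c : Ω)).mp c.2
  have hc0' : (c : Ω) ≠ 0 := fun h => hc0 (Subtype.ext h)
  have hPx : aeval x₁ P ≠ 0 := fun h => hc0' (by rw [hPQ, h, zero_div])
  have hQx : aeval x₁ Q ≠ 0 := fun h => hc0' (by rw [hPQ, h, div_zero])
  have hP : P ≠ 0 := fun h => hPx (by simp [h])
  have hQ : Q ≠ 0 := fun h => hQx (by simp [h])
  let σK : K →ₐ[F] K := (σ.comp K.val).codRestrict K.toSubalgebra (fun a => hK a a.2)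
  have hσP : ∀ p : K[X], σ (aeval x₁ p) =
      aeval x₁ ((p.map (σK : K →+* K)).comp (g.map (algebraMap F K))) := by
    intro p
    rw [aeval_comp, aeval_map_algebraMap, ← h₁, aeval_def, aeval_def, eval₂_map]
    exact hom_eval₂ p (algebraMap K Ω) (σ : Ω →+* Ω) x₁
  let b : K := aeval (⟨x₂, hx₂⟩ : K) (derivative g) ^ r
  have hbΩ : algebraMap K Ω b = aeval x₂ (derivative g) ^ r := by
    rw [_root_.map_pow, ← aeval_algebraMap_apply]; rfl
  have hb : b ≠ 0 := by
    intro h0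
    rw [h0, _root_.map_zero] at hbΩ
    exact pow_ne_zero r hgx₂ hbΩ.symm
  have heq : (P.map (σK : K →+* K)).comp (g.map (algebraMap F K)) * Q *
      derivative (g.map (algebraMap F K)) ^ r =
      C b * (P * (Q.map (σK : K →+* K)).comp (g.map (algebraMap F K))) := by
    refine transcendental_iff_injective.mp ht ?_
    simp only [map_mul, _root_.map_pow, ← hσP, aeval_C, hbΩ, derivative_map,
      aeval_map_algebraMap]
    have hc' : σ (c : Ω) = (aeval x₂ (derivative g) / aeval x₁ (derivative g)) ^ r * c :=
      congrArg Subtype.val hc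
    have hQσ : σ (aeval x₁ Q) ≠ 0 := (_root_.map_ne_zero σ).mpr hQx
    rw [hPQ, map_div₀, div_pow] at hc'
    field_simp at hc'
    linear_combination hc'
  obtain ⟨P₀, Q₀, c₀, h⟩ := exists_functional_equation_of_twisted σK hg hg' hP hQ hb heq
  exact ⟨r, P₀, Q₀, c₀, minpoly.natDegree_pos hint, h⟩

section RelAlgClosure

variable {F Ω : Type} [Field F] [Field Ω] [Algebra F Ω]

/-- The relative algebraic closure in `Ω` of the subfield generated over `F` by a set. -/
noncomputable def relAlgClosure (F : Type) {Ω : Type} [Field F] [Field Ω] [Algebra F Ω]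
    (s : Set Ω) : IntermediateField F Ω :=
  (algebraicClosure (IntermediateField.adjoin F s) Ω).restrictScalars F

theorem mem_relAlgClosure_iff {s : Set Ω} {z : Ω} :
    z ∈ relAlgClosure F s ↔ IsAlgebraic (Algebra.adjoin F s) z := by
  rw [← IntermediateField.isAlgebraic_adjoin_iff]
  exact mem_algebraicClosure_iff

theorem coe_relAlgClosure (s : Set Ω) :
    (relAlgClosure F s : Set Ω) = (AlgebraicIndependent.matroid F Ω).closure s := by
  ext z
  rw [AlgebraicIndependent.matroid_closure_eq]
  simp only [SetLike.mem_coe, mem_relAlgClosure_iff, Subalgebra.mem_algebraicClosure]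

theorem mem_relAlgClosure_iff_mem_closure {s : Set Ω} {z : Ω} :
    z ∈ relAlgClosure F s ↔ z ∈ (AlgebraicIndependent.matroid F Ω).closure s := by
  rw [← coe_relAlgClosure]; rfl

theorem subset_relAlgClosure (s : Set Ω) : s ⊆ relAlgClosure F s := fun z hz => by
  rw [SetLike.mem_coe, mem_relAlgClosure_iff]
  exact isAlgebraic_algebraMap (⟨z, Algebra.subset_adjoin hz⟩ : Algebra.adjoin F s)

theorem transcendental_relAlgClosure {s : Set Ω} {z : Ω} (hz : z ∉ relAlgClosure F s) :
    Transcendental (relAlgClosure F s) z := by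
  have h1 : Transcendental (IntermediateField.adjoin F s) z := fun h =>
    hz (mem_algebraicClosure_iff.mpr h)
  exact h1.algebraicClosure

theorem isAlgebraic_adjoin_of_mem_relAlgClosure_insert {s : Set Ω} {x z : Ω}
    (hz : z ∈ relAlgClosure F (insert x s)) :
    IsAlgebraic (IntermediateField.adjoin (relAlgClosure F s) {x}) z := by
  rw [mem_relAlgClosure_iff] at hz
  let M := IntermediateField.adjoin (relAlgClosure F s) {x}
  have hx : x ∈ M := IntermediateField.mem_adjoin_simple_self _ x
  have hs : ∀ y ∈ s, y ∈ M := fun y hy =>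
    M.algebraMap_mem (⟨y, subset_relAlgClosure s hy⟩ : relAlgClosure F s)
  have hle : ∀ a ∈ Algebra.adjoin F (insert x s), a ∈ M.toSubfield := by
    intro a ha
    induction ha using Algebra.adjoin_induction with
    | mem y hy =>
      rcases hy with rfl | hy
      exacts [hx, hs y hy]
    | algebraMap c => exact (M.restrictScalars F).algebraMap_mem c
    | add a b _ _ ha hb => exact add_mem ha hb
    | mul a b _ _ ha hb => exact mul_mem ha hb
  let j : Algebra.adjoin F (insert x s) →+* M :=
    (algebraMap (Algebra.adjoin F (insert x s)) Ω).codRestrict M.toSubfield (fun a => hle a a.2)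
  have hj : Function.Injective j := fun a b h =>
    Subtype.ext (show (j a : Ω) = j b by rw [h])
  have h := hz.ringHom_of_comp_eq (S := M) (B := Ω) j (RingHom.id Ω) hj rfl
  exact h

theorem map_mem_relAlgClosure (σ : Ω →ₐ[F] Ω) {s : Set Ω}
    (hs : ∀ y ∈ s, σ y ∈ Algebra.adjoin F s) {z : Ω} (hz : z ∈ relAlgClosure F s) :
    σ z ∈ relAlgClosure F s := by
  rw [mem_relAlgClosure_iff] at hz ⊢
  have hle : Algebra.adjoin F s ≤ (Algebra.adjoin F s).comap σ := Algebra.adjoin_le hs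
  let σA : Algebra.adjoin F s →ₐ[F] Algebra.adjoin F s :=
    (σ.comp (Algebra.adjoin F s).val).codRestrict _ (fun a => hle a.2)
  have hinj : Function.Injective σA := fun a b h =>
    Subtype.ext (σ.toRingHom.injective (congrArg Subtype.val h))
  exact hz.ringHom_of_comp_eq (σA : _ →+* _) (σ : Ω →+* Ω) hinj rfl

end RelAlgClosure

/-- If `F`-endomorphism `σ` acts on a family `y` through a polynomial `g`, and `g` admits no
functional equation of the kind considered above, then every member of the family is algebraic
over `F` or over `F(b)` for a single member `b` of a given transcendence basis. -/
theorem mem_closure_singleton_of_endomorphism {F Ω ι : Type} [Field F] [Field Ω] [Algebra F Ω]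
    [IsAlgClosed F] [CharZero F] (σ : Ω →ₐ[F] Ω) {g : F[X]} (hg : 2 ≤ g.natDegree)
    (hno : ¬ ∃ (r : ℕ) (P Q : F[X]) (c : F), 1 ≤ r ∧ P ≠ 0 ∧ Q ≠ 0 ∧ c ≠ 0 ∧
      P.comp g * Q * derivative g ^ r = C c * (P * Q.comp g))
    (y : ι → Ω) (hy : ∀ i, σ (y i) = aeval (y i) g) {B : Set ι}
    (hspan : ∀ z : Ω, z ∈ relAlgClosure F (y '' B))
    (hB : ((AlgebraicIndependent.matroid F Ω).comap y).IsBase B) (i : ι) :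
    i ∈ ((AlgebraicIndependent.matroid F Ω).comap y).closure ∅ ∨
      ∃ b ∈ B, i ∈ ((AlgebraicIndependent.matroid F Ω).comap y).closure {b} := by
  set N := (AlgebraicIndependent.matroid F Ω).comap y with hN
  have hE : N.E = Set.univ := by simp [hN]
  have hmem : ∀ (S : Set ι) (j : ι), j ∈ N.closure S ↔ y j ∈ relAlgClosure F (y '' S) := by
    intro S j
    rw [hN, Matroid.comap_closure_eq, mem_relAlgClosure_iff_mem_closure]; rfl
  have hstable : ∀ S : Set ι, ∀ z ∈ relAlgClosure F (y '' S), σ z ∈ relAlgClosure F (y '' S) := by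
    intro S z hz
    refine map_mem_relAlgClosure σ ?_ hz
    rintro _ ⟨j, hj, rfl⟩
    rw [hy]
    exact Algebra.adjoin_mono (Set.singleton_subset_iff.mpr (Set.mem_image_of_mem y hj))
      (aeval_mem_adjoin_singleton F (y j))
  have hspan' : ∀ S : Set ι, B ⊆ N.closure S → ∀ z : Ω, z ∈ relAlgClosure F (y '' S) := by
    intro S hS z
    have h1 := hspan z
    rw [mem_relAlgClosure_iff_mem_closure] at h1 ⊢
    refine Matroid.closure_subset_closure_of_subset_closure ?_ h1
    rintro _ ⟨b, hb, rfl⟩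
    exact mem_relAlgClosure_iff_mem_closure.mp ((hmem S b).mp (hS hb))
  have hi : i ∈ N.closure B := by rw [hB.closure_eq, hE]; trivial
  have hex : ∀ b ∈ B, i ∉ N.closure (B \ {b}) → B ⊆ N.closure (insert i (B \ {b})) := by
    intro b hb hib c hc
    by_cases hcb : c = b
    · subst hcb
      refine (Matroid.closure_exchange (M := N) (X := B \ {c}) (e := i) (f := c) ⟨?_, hib⟩).1
      rwa [Set.insert_sdiff_singleton, Set.insert_eq_of_mem hb]
    · exact N.mem_closure_of_mem' (Set.mem_insert_of_mem _ ⟨hc, hcb⟩) (by rw [hE]; trivial)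
  have huniq : ∀ b ∈ B, ∀ b' ∈ B, i ∉ N.closure (B \ {b}) → i ∉ N.closure (B \ {b'}) →
      b = b' := by
    intro b hb b' hb' h h'
    by_contra hne
    refine hno (exists_functional_equation_of_endomorphism σ hg (hy i) (hy b)
      (relAlgClosure F (y '' (B \ {b}))) (relAlgClosure F (y '' (B \ {b'})))
      (hstable _) (hstable _)
      (transcendental_relAlgClosure fun hm => h ((hmem _ _).mpr hm))
      (transcendental_relAlgClosure fun hm => h' ((hmem _ _).mpr hm))
      (subset_relAlgClosure _ ⟨b, ⟨hb, hne⟩, rfl⟩) ?_ ?_ ?_)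
    · intro z
      refine isAlgebraic_adjoin_of_mem_relAlgClosure_insert ?_
      rw [← Set.image_insert_eq]
      exact hspan' _ (hex b hb h) z
    · intro z
      refine isAlgebraic_adjoin_of_mem_relAlgClosure_insert ?_
      rw [← Set.image_insert_eq, Set.insert_sdiff_singleton, Set.insert_eq_of_mem hb]
      exact hspan z
    · intro z
      refine isAlgebraic_adjoin_of_mem_relAlgClosure_insert ?_
      rw [← Set.image_insert_eq]
      exact hspan' _ (hex b' hb' h') z
  by_cases hall : ∀ b ∈ B, i ∈ N.closure (B \ {b})
  · left
    have h1 := hB.indep.closure_iInter_eq_biInter_closure_of_forall_subset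
      (Js := fun o : Option B => o.elim B fun b => B \ {(b : ι)})
      (by rintro (_ | b); exacts [subset_rfl, Set.sdiff_subset])
    have h2 : (⋂ o : Option B, o.elim B fun b => B \ {(b : ι)}) = ∅ := by
      refine Set.eq_empty_of_forall_notMem fun x hx => ?_
      have hx0 := Set.mem_iInter.mp hx
      exact (hx0 (Option.some ⟨x, hx0 none⟩)).2 rfl
    rw [← h2, h1]
    refine Set.mem_iInter.mpr ?_
    rintro (_ | b)
    exacts [hi, hall b b.2]
  · push Not at hall
    obtain ⟨b₀, hb₀, hib₀⟩ := hall
    refine Or.inr ⟨b₀, hb₀, ?_⟩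
    have h1 := hB.indep.closure_iInter_eq_biInter_closure_of_forall_subset
      (Js := fun o : Option (B \ {b₀} : Set ι) => o.elim B fun b => B \ {(b : ι)})
      (by rintro (_ | b); exacts [subset_rfl, Set.sdiff_subset])
    have h2 : (⋂ o : Option (B \ {b₀} : Set ι), o.elim B fun b => B \ {(b : ι)}) ⊆ {b₀} := by
      intro x hx
      have hx0 := Set.mem_iInter.mp hx
      by_contra hne
      exact (hx0 (Option.some ⟨x, hx0 none, hne⟩)).2 rfl
    refine N.closure_subset_closure h2 ?_
    rw [h1]
    refine Set.mem_iInter.mpr ?_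
    rintro (_ | b)
    · exact hi
    · by_contra hne
      exact b.2.2 (huniq b b.2.1 b₀ hb₀ hne hib₀)

theorem map_mem_relAlgClosure_iff {F A A' : Type} [Field F] [Field A] [Field A'] [Algebra F A]
    [Algebra F A'] (φ : A →ₐ[F] A') {s : Set A} {z : A} :
    φ z ∈ relAlgClosure F (φ '' s) ↔ z ∈ relAlgClosure F s := by
  rw [mem_relAlgClosure_iff, mem_relAlgClosure_iff]
  have hmap : (Algebra.adjoin F s).map φ = Algebra.adjoin F (φ '' s) := AlgHom.map_adjoin φ s
  let j : Algebra.adjoin F s →+* Algebra.adjoin F (φ '' s) :=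
    ((φ : A →+* A').comp (algebraMap (Algebra.adjoin F s) A)).codRestrict
      (Algebra.adjoin F (φ '' s)).toSubring
      (fun a => hmap ▸ Subalgebra.mem_map.mpr ⟨a, a.2, rfl⟩)
  have hj : ∀ a, (j a : A') = φ a := fun a => rfl
  have hinj : Function.Injective j := fun a b h =>
    Subtype.ext (φ.toRingHom.injective (show φ a = φ b by rw [← hj, ← hj, h]))
  have hsurj : Function.Surjective j := by
    rintro ⟨b, hb⟩
    rw [← hmap] at hb
    obtain ⟨a, ha, rfl⟩ := Subalgebra.mem_map.mp hb
    exact ⟨⟨a, ha⟩, rfl⟩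
  exact ⟨fun h => h.of_ringHom_of_comp_eq j (φ : A →+* A') hsurj φ.toRingHom.injective rfl,
    fun h => h.ringHom_of_comp_eq j (φ : A →+* A') hinj rfl⟩

theorem mem_relAlgClosure_of_isAlgebraic {F Ω E : Type} [Field F] [Field Ω] [Algebra F Ω] [Field E]
    [Algebra E Ω] {s : Set Ω} (hE : ∀ a : E, algebraMap E Ω a ∈ relAlgClosure F s) {z : Ω}
    (hz : IsAlgebraic E z) : z ∈ relAlgClosure F s := by
  by_contra hcon
  refine transcendental_relAlgClosure hcon ?_
  let j : E →+* relAlgClosure F s := (algebraMap E Ω).codRestrict (relAlgClosure F s).toSubfield hE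
  exact hz.ringHom_of_comp_eq j (RingHom.id Ω) j.injective rfl

open scoped IntermediateField.algebraAdjoinAdjoin in
/-- The endomorphism of an algebraic closure of `F(y)` induced by a polynomial `g` preserving the
algebraic relations between the members of the family `y`. -/
theorem exists_endomorphism_of_relations {F L ι : Type} [Field F] [Field L] [Algebra F L]
    {g : F[X]} (y : ι → L)
    (h : ∀ q : MvPolynomial ι F,
      MvPolynomial.aeval y q = 0 ↔ MvPolynomial.aeval (fun i => aeval (y i) g) q = 0) :
    ∃ (Ω : Type) (_ : Field Ω) (_ : Algebra F Ω) (E : IntermediateField F L) (φ : E →ₐ[F] Ω)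
      (y' : ι → E) (σ : Ω →ₐ[F] Ω), (∀ i, (y' i : L) = y i) ∧
      (∀ i, σ (φ (y' i)) = aeval (φ (y' i)) g) ∧
      ∀ s : Set Ω, (∀ i, φ (y' i) ∈ relAlgClosure F s) → ∀ z : Ω, z ∈ relAlgClosure F s := by
  let E := IntermediateField.adjoin F (Set.range y)
  let R := Algebra.adjoin F (Set.range y)
  let Ω := AlgebraicClosure E
  let y' : ι → E := fun i => ⟨y i, IntermediateField.subset_adjoin _ _ ⟨i, rfl⟩⟩
  let φ : E →ₐ[F] Ω := IsScalarTower.toAlgHom F E Ω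
  let y₂ : ι → E := fun i => aeval (y' i) g
  have hy' : ∀ q : MvPolynomial ι F, ((MvPolynomial.aeval y' q : E) : L) =
      MvPolynomial.aeval y q := fun q => by
    have := MvPolynomial.aeval_algebraMap_apply (A := E) L y' q
    exact this.symm
  have hy₂ : ∀ q : MvPolynomial ι F, ((MvPolynomial.aeval y₂ q : E) : L) =
      MvPolynomial.aeval (fun i => aeval (y i) g) q := fun q => by
    have := MvPolynomial.aeval_algebraMap_apply (A := E) L y₂ q
    refine this.symm.trans ?_
    congr 2
    ext i
    exact (aeval_algebraMap_apply L (y' i) g).symm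
  have hker : ∀ q : MvPolynomial ι F, MvPolynomial.aeval y q = 0 ↔
      MvPolynomial.aeval (fun i => φ (y₂ i)) q = 0 := fun q => by
    have h1 : MvPolynomial.aeval (fun i => φ (y₂ i)) q = φ (MvPolynomial.aeval y₂ q) :=
      (MvPolynomial.comp_aeval_apply _ φ q).symm
    rw [h q, h1, map_eq_zero_iff φ φ.toRingHom.injective, ← hy₂ q]
    exact ZeroMemClass.coe_eq_zero
  have hRrange : R = (MvPolynomial.aeval (R := F) y).range := Algebra.adjoin_range_eq_range_aeval F y
  have hsurj : Function.Surjective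
      ((MvPolynomial.aeval (R := F) y).codRestrict R (fun q => hRrange ▸ ⟨q, rfl⟩)) := by
    rintro ⟨r, hr⟩
    have hr' := hr
    rw [hRrange] at hr'
    obtain ⟨q, hq⟩ := hr'
    exact ⟨q, Subtype.ext hq⟩
  set π := (MvPolynomial.aeval (R := F) y).codRestrict R (fun q => hRrange ▸ ⟨q, rfl⟩) with hπ
  have hπ0 : ∀ q, π q = 0 ↔ MvPolynomial.aeval (fun i => φ (y₂ i)) q = 0 := fun q => by
    rw [← hker, ← ZeroMemClass.coe_eq_zero]; rfl
  let ρ₀ : (MvPolynomial ι F ⧸ RingHom.ker π) →ₐ[F] Ω :=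
    Ideal.Quotient.liftₐ (RingHom.ker π) (MvPolynomial.aeval (fun i => φ (y₂ i)))
      (fun q hq => (hπ0 q).mp hq)
  let ρ : R →ₐ[F] Ω := ρ₀.comp (Ideal.quotientKerAlgEquivOfSurjective hsurj).symm.toAlgHom
  have hρ : ∀ q, ρ (π q) = MvPolynomial.aeval (fun i => φ (y₂ i)) q := fun q => by
    have h1 : (Ideal.quotientKerAlgEquivOfSurjective hsurj).symm (π q) =
        Ideal.Quotient.mk _ q := by
      rw [AlgEquiv.symm_apply_eq]; rfl
    change ρ₀ ((Ideal.quotientKerAlgEquivOfSurjective hsurj).symm (π q)) = _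
    rw [h1]; rfl
  have hρinj : Function.Injective ρ := by
    rw [injective_iff_map_eq_zero]
    intro r hr
    obtain ⟨q, rfl⟩ := hsurj r
    rw [hρ] at hr
    exact (hπ0 q).mpr hr
  let ρE : E →ₐ[F] Ω := IsFractionRing.liftAlgHom (A := R) (K := E) hρinj
  obtain ⟨σ, hσ⟩ := IsAlgClosed.surjective_domRestrict_of_isAlgebraic (K := F) (L := E) (E := Ω)
    (M := Ω) ρE
  have hσ' : ∀ a : E, σ (φ a) = ρE a := fun a => DFunLike.congr_fun hσ a
  refine ⟨Ω, inferInstance, inferInstance, E, φ, y', σ, fun i => rfl, fun i => ?_, ?_⟩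
  · have h1 : (y' i) = algebraMap R E (π (MvPolynomial.X i)) := by
      apply Subtype.ext
      change y i = MvPolynomial.aeval y (MvPolynomial.X i)
      rw [MvPolynomial.aeval_X]
    have h2 : ρE (y' i) = ρ (π (MvPolynomial.X i)) := by
      rw [h1]
      exact IsFractionRing.lift_algebraMap hρinj _
    rw [hσ', h2, hρ, MvPolynomial.aeval_X]
    exact (aeval_algHom_apply φ (y' i) g).symm
  · intro s hs z
    refine mem_relAlgClosure_of_isAlgebraic (E := E) ?_ (Algebra.IsAlgebraic.isAlgebraic z)
    rintro ⟨a, ha⟩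
    induction ha using IntermediateField.adjoin_induction with
    | mem x hx => obtain ⟨i, rfl⟩ := hx; exact hs i
    | algebraMap c => exact (relAlgClosure F s).algebraMap_mem c
    | add a b h₁ h₂ ha hb =>
      have : φ (⟨a + b, add_mem h₁ h₂⟩ : E) = φ ⟨a, h₁⟩ + φ ⟨b, h₂⟩ :=
        _root_.map_add φ ⟨a, h₁⟩ ⟨b, h₂⟩
      exact this ▸ add_mem ha hb
    | inv a h₁ ha =>
      have : φ (⟨a⁻¹, inv_mem h₁⟩ : E) = (φ ⟨a, h₁⟩)⁻¹ := map_inv₀ φ ⟨a, h₁⟩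
      exact this ▸ inv_mem ha
    | mul a b h₁ h₂ ha hb =>
      have : φ (⟨a * b, mul_mem h₁ h₂⟩ : E) = φ ⟨a, h₁⟩ * φ ⟨b, h₂⟩ := map_mul φ ⟨a, h₁⟩ ⟨b, h₂⟩
      exact this ▸ mul_mem ha hb

/-- A family whose algebraic relations are preserved by a polynomial `g` without functional
equations splits into one-dimensional blocks. -/
theorem exists_blocks_of_relations {F L ι : Type} [Field F] [Field L] [Algebra F L]
    [IsAlgClosed F] [CharZero F] {g : F[X]} (hg : 2 ≤ g.natDegree)
    (hno : ¬ ∃ (r : ℕ) (P Q : F[X]) (c : F), 1 ≤ r ∧ P ≠ 0 ∧ Q ≠ 0 ∧ c ≠ 0 ∧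
      P.comp g * Q * derivative g ^ r = C c * (P * Q.comp g))
    (y : ι → L)
    (h : ∀ q : MvPolynomial ι F,
      MvPolynomial.aeval y q = 0 ↔ MvPolynomial.aeval (fun i => aeval (y i) g) q = 0) :
    ∃ B : Set ι, AlgebraicIndependent F (fun b : B => y b) ∧
      ∀ i, y i ∈ relAlgClosure F (∅ : Set L) ∨ ∃ b ∈ B, y i ∈ relAlgClosure F {y b} := by
  obtain ⟨Ω, _, _, E, φ, y', σ, hy', hσ, hΩ⟩ := exists_endomorphism_of_relations y h
  set N := (AlgebraicIndependent.matroid F Ω).comap (fun i => φ (y' i)) with hN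
  obtain ⟨B, hB⟩ := N.exists_isBase
  have hmem : ∀ (S : Set ι) (j : ι), j ∈ N.closure S ↔ y j ∈ relAlgClosure F (y '' S) := by
    intro S j
    rw [hN, Matroid.comap_closure_eq, Set.mem_preimage, ← mem_relAlgClosure_iff_mem_closure,
      show (fun i => φ (y' i)) '' S = φ '' (Set.image y' S) by rw [Set.image_image],
      map_mem_relAlgClosure_iff, ← map_mem_relAlgClosure_iff E.val, Set.image_image]
    simp [hy']
  have hspan : ∀ z : Ω, z ∈ relAlgClosure F ((fun i => φ (y' i)) '' B) := by
    refine hΩ _ fun i => ?_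
    have h1 : i ∈ N.closure B := by rw [hB.closure_eq]; exact Set.mem_univ _
    rw [hN, Matroid.comap_closure_eq, Set.mem_preimage] at h1
    exact mem_relAlgClosure_iff_mem_closure.mpr h1
  refine ⟨B, ?_, fun i => ?_⟩
  · have h1 := hB.indep
    rw [hN, Matroid.comap_indep_iff, AlgebraicIndependent.matroid_indep_iff] at h1
    have h2 : AlgebraicIndependent F (fun b : B => φ (y' b)) :=
      (algebraicIndependent_image h1.2).mpr h1.1
    have h3 : AlgebraicIndependent F (fun b : B => y' b) :=
      (AlgHom.algebraicIndependent_iff φ φ.toRingHom.injective).mp h2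
    have h4 := (AlgHom.algebraicIndependent_iff E.val E.val.toRingHom.injective).mpr h3
    rwa [show (E.val ∘ fun b : B => y' b) = fun b : B => y b from funext fun b => hy' b] at h4
  · rcases mem_closure_singleton_of_endomorphism σ hg hno _ hσ hspan hB i with h1 | ⟨b, hb, h1⟩
    · left; simpa using (hmem _ _).mp h1
    · right; exact ⟨b, hb, by simpa using (hmem _ _).mp h1⟩

theorem mem_relAlgClosure_empty_iff {F L : Type} [Field F] [Field L] [Algebra F L]
    [IsAlgClosed F] {z : L} : z ∈ relAlgClosure F (∅ : Set L) ↔ ∃ c, algebraMap F L c = z := by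
  constructor
  · intro h
    rw [mem_relAlgClosure_iff, Algebra.adjoin_empty] at h
    have h1 : IsAlgebraic F z :=
      h.ringHom_of_comp_eq (S := F) (B := L) (Algebra.botEquiv F L : _ →+* F) (RingHom.id L)
        (Algebra.botEquiv F L).injective (by
          ext b
          obtain ⟨c, rfl⟩ := (Algebra.botEquiv F L).symm.surjective b
          simp)
    have h2 := IsAlgClosed.degree_eq_one_of_irreducible F (minpoly.irreducible h1.isIntegral)
    exact minpoly.mem_range_of_degree_eq_one F z h2
  · rintro ⟨c, rfl⟩
    exact (relAlgClosure F (∅ : Set L)).algebraMap_mem c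

/-- Over a subfield `B` over which `t` is transcendental, families in `B` that are linearly
independent over `F` remain so over the relative algebraic closure of `F(t)`. -/
theorem eq_zero_of_sum_mul_eq_zero_of_mem_relAlgClosure {F L κ : Type} [Field F] [Field L]
    [Algebra F L] [IsAlgClosed F] [CharZero F] (B : IntermediateField F L) {t : L}
    (ht : Transcendental B t) (e : κ → L) (hB : ∀ s, e s ∈ B) (he : LinearIndependent F e)
    (A : IntermediateField F L) (hA : A = relAlgClosure F {t})
    (S : Finset κ) (a : κ → A) (h : ∑ s ∈ S, (a s : L) * e s = 0) :
    ∀ s ∈ S, a s = 0 := by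
  classical
  have : CharZero L := charZero_of_injective_algebraMap (algebraMap F L).injective
  have : CharZero B := charZero_of_injective_algebraMap (algebraMap F B).injective
  let t' : A := ⟨t, hA ▸ subset_relAlgClosure _ rfl⟩
  have htF : Transcendental F t := fun h => ht (h.tower_top B)
  have htF' : Transcendental F t' := by
    intro h
    exact htF (h.algHom A.val)
  have hgen : ∀ z : A, z ∈ relAlgClosure F {t'} := by
    intro z
    rw [← map_mem_relAlgClosure_iff A.val, Set.image_singleton]
    exact hA.le z.2
  obtain ⟨δ, hδ⟩ := exists_derivation_apply_eq_one ht
  obtain ⟨D, hD⟩ := exists_derivation_apply_eq_one htF'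
  have hres : ∀ z : A, δ (z : L) = D z := by
    intro z
    let E : A →+ L :=
      (δ : L →+ L).comp (A.val : A →+ L) - (A.val : A →+ L).comp (D : A →+ A)
    have hE : ∀ z, E z = δ (z : L) - (D z : L) := fun z => rfl
    have := twisted_derivation_eq_zero (K := F) (A.val : A →+* L) E
      (fun z w => by
        simp only [hE, MulMemClass.coe_mul, Derivation.leibniz, smul_eq_mul, AddMemClass.coe_add,
          RingHom.coe_coe, IntermediateField.coe_val]
        ring)
      (fun c => by
        have h1 : δ (algebraMap F L c) = 0 := by
          rw [IsScalarTower.algebraMap_apply F B L]; exact δ.map_algebraMap _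
        have h2 : ((algebraMap F A c : A) : L) = algebraMap F L c := rfl
        rw [hE, h2, h1, D.map_algebraMap]; simp)
      (x := t') (by rw [hE, hD, hδ]; simp) (z := z) (mem_algebraicClosure_iff.mp (hgen z))
    rw [hE, sub_eq_zero] at this
    exact this
  have hker : ∀ z : A, D z = 0 → ∃ c : F, algebraMap F A c = z := by
    intro z hz
    by_contra hne
    have hz0 : z ∉ relAlgClosure F (∅ : Set A) := by
      intro h0
      exact hne (mem_relAlgClosure_empty_iff.mp h0)
    have h1 : t' ∈ relAlgClosure F {z} := by
      have := Matroid.closure_exchange (M := AlgebraicIndependent.matroid F A) (X := ∅) (e := z)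
        (f := t') ⟨?_, ?_⟩
      · simpa [mem_relAlgClosure_iff_mem_closure] using this.1
      · rw [← mem_relAlgClosure_iff_mem_closure]; simpa using hgen z
      · rwa [← mem_relAlgClosure_iff_mem_closure]
    have h2 := twisted_derivation_eq_zero (K := F) (RingHom.id A) (D : A →+ A)
      (fun z w => by simp) (fun c => by simp) (x := z) hz
      (mem_algebraicClosure_iff.mp h1)
    have h3 : D t' = 0 := h2
    rw [hD] at h3
    exact one_ne_zero h3
  induction S using Finset.induction_on generalizing a with
  | empty => simp
  | insert s₀ S hs₀ ih =>
    rw [Finset.sum_insert hs₀] at h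
    by_cases h0 : a s₀ = 0
    · rw [h0] at h
      have := ih a (by simpa using h)
      intro s hs
      rcases Finset.mem_insert.mp hs with rfl | hs
      exacts [h0, this s hs]
    exfalso
    have h0' : (a s₀ : L) ≠ 0 := fun h => h0 (Subtype.ext h)
    have h1 : e s₀ + ∑ s ∈ S, ((a s / a s₀ : A) : L) * e s = 0 := by
      have : e s₀ + ∑ s ∈ S, ((a s / a s₀ : A) : L) * e s =
          (a s₀ : L)⁻¹ * (a s₀ * e s₀ + ∑ s ∈ S, (a s : L) * e s) := by
        rw [mul_add, Finset.mul_sum, inv_mul_cancel_left₀ h0']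
        congr 1
        refine Finset.sum_congr rfl fun s _ => ?_
        rw [IntermediateField.coe_div]; field_simp
      rw [this, h, mul_zero]
    have hδe : ∀ s, δ (e s) = 0 := fun s => δ.map_algebraMap (⟨e s, hB s⟩ : B)
    have h2 : ∑ s ∈ S, ((D (a s / a s₀) : A) : L) * e s = 0 := by
      have := congrArg δ h1
      rw [_root_.map_add, _root_.map_sum, _root_.map_zero, hδe, zero_add] at this
      rw [← this]
      refine Finset.sum_congr rfl fun s _ => ?_
      rw [Derivation.leibniz, hδe, hres, smul_zero, zero_add, smul_eq_mul, mul_comm]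
    have h3 := ih (fun s => D (a s / a s₀)) h2
    have h4 : ∀ s, ∃ c : F, s ∈ S → algebraMap F A c = a s / a s₀ := by
      intro s
      by_cases hs : s ∈ S
      · obtain ⟨c, hc⟩ := hker _ (h3 s hs); exact ⟨c, fun _ => hc⟩
      · exact ⟨0, fun h => absurd h hs⟩
    choose c hc using h4
    have h5 : ∑ s ∈ insert s₀ S, (if s = s₀ then 1 else c s) • e s = 0 := by
      rw [Finset.sum_insert hs₀, if_pos rfl, one_smul, ← h1]
      congr 1
      refine Finset.sum_congr rfl fun s hs => ?_
      rw [if_neg (show s ≠ s₀ from fun hs' => hs₀ (hs' ▸ hs)), Algebra.smul_def, ← hc s hs]; rfl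
    have h6 := linearIndependent_iff'.mp he _ _ h5 s₀ (Finset.mem_insert_self _ _)
    simp at h6

/-- Algebraic relations specialise along linearly disjoint subfields. -/
theorem sum_smul_eq_zero_of_relations {F L σ : Type} [Field F] [Field L]
    [Algebra F L] [IsAlgClosed F] [CharZero F] (B : IntermediateField F L) {t : L}
    (ht : Transcendental B t) (S : Finset σ) (a : σ → relAlgClosure F {t}) (b : σ → B)
    (h : ∑ m ∈ S, (a m : L) * b m = 0) (x : σ → F)
    (hx : ∀ w : σ → F, ∑ m ∈ S, w m • (a m : L) = 0 → ∑ m ∈ S, w m * x m = 0) :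
    ∑ m ∈ S, x m • (b m : L) = 0 := by
  classical
  let e := Module.Basis.ofVectorSpace F B
  set T := S.biUnion fun m => (e.repr (b m)).support with hT
  have hb : ∀ m ∈ S, (b m : L) = ∑ s ∈ T, e.repr (b m) s • (e s : L) := by
    intro m hm
    have h1 : b m = ∑ s ∈ T, e.repr (b m) s • e s := by
      conv_lhs => rw [← e.linearCombination_repr (b m)]
      rw [Finsupp.linearCombination_apply]
      refine Finsupp.sum_of_support_subset _ ?_ _ (by simp)
      exact Finset.subset_biUnion_of_mem (fun m => (e.repr (b m)).support) hm
    conv_lhs => rw [h1]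
    simp
  have hlin : LinearIndependent F fun s => (e s : L) :=
    e.linearIndependent.map' B.val.toLinearMap
      (LinearMap.ker_eq_bot.mpr B.val.toRingHom.injective)
  have h1 : ∑ s ∈ T, ((∑ m ∈ S, e.repr (b m) s • a m : relAlgClosure F {t}) : L) * e s = 0 := by
    rw [← h, ← sub_eq_zero, sub_eq_zero]
    have : ∀ m ∈ S, (a m : L) * b m = ∑ s ∈ T, e.repr (b m) s • ((a m : L) * e s) := by
      intro m hm
      conv_lhs => rw [hb m hm, Finset.mul_sum]
      simp
    rw [Finset.sum_congr rfl this, Finset.sum_comm]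
    refine Finset.sum_congr rfl fun s _ => ?_
    simp [Finset.sum_mul]
  have h2 := eq_zero_of_sum_mul_eq_zero_of_mem_relAlgClosure B ht _ (fun s => (e s).2) hlin _ rfl T _ h1
  have h3 : ∀ s ∈ T, ∑ m ∈ S, e.repr (b m) s * x m = 0 := by
    intro s hs
    refine hx _ ?_
    have := congrArg (fun z : relAlgClosure F {t} => (z : L)) (h2 s hs)
    simpa using this
  have h4 : ∑ m ∈ S, x m • (b m : L) = ∑ s ∈ T, (∑ m ∈ S, e.repr (b m) s * x m) • (e s : L) := by
    have : ∀ m ∈ S, x m • (b m : L) = ∑ s ∈ T, (e.repr (b m) s * x m) • (e s : L) := by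
      intro m hm
      conv_lhs => rw [hb m hm, Finset.smul_sum]
      refine Finset.sum_congr rfl fun s _ => ?_
      rw [smul_smul, mul_comm]
    rw [Finset.sum_congr rfl this, Finset.sum_comm]
    simp only [Finset.sum_smul]
  rw [h4]
  exact Finset.sum_eq_zero fun s hs => by rw [h3 s hs, zero_smul]

section Specialization

variable {F L ι : Type} [Field F] [Field L] [Algebra F L]

/-- Evaluation of polynomials in homogeneous coordinates at a point of `(P^1(L))^ι`. -/
noncomputable def homEval (x : ι → OnePoint L) : MvPolynomial (ι × Fin 2) F →ₐ[F] L :=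
  MvPolynomial.aeval fun jk => homCoords (x jk.1) jk.2

@[simp]
theorem homEval_X (x : ι → OnePoint L) (jk : ι × Fin 2) :
    homEval (F := F) x (MvPolynomial.X jk) = homCoords (x jk.1) jk.2 :=
  MvPolynomial.aeval_X _ _

@[simp]
theorem homEval_C (x : ι → OnePoint L) (c : F) :
    homEval x (MvPolynomial.C c) = algebraMap F L c :=
  MvPolynomial.aeval_C _ _

theorem vanishesAt_id_iff [DecidableEq ι] (p : MvPolynomial (ι × Fin 2) F)
    (x : ι → OnePoint F) : vanishesAt (RingHom.id F) p x ↔ homEval x p = 0 := by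
  rw [vanishesAt, MvPolynomial.map_id, homEval, MvPolynomial.aeval_eq_eval]

@[simp]
theorem homCoords_coe (a : L) : homCoords (a : OnePoint L) = ![a, 1] := rfl

@[simp]
theorem homCoords_infty : homCoords (∞ : OnePoint L) = ![1, 0] := rfl

theorem homCoords_ne_zero (a : OnePoint L) : ∃ k, homCoords a k ≠ 0 := by
  cases a with
  | infty => exact ⟨0, by simp⟩
  | coe a => exact ⟨1, by simp⟩

/-- The inclusion of the `F`-points of the projective line into the `L`-points. -/
def liftP1 (L : Type) [Field L] [Algebra F L] : OnePoint F → OnePoint L :=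
  OnePoint.map (algebraMap F L)

theorem homCoords_liftP1 (c : OnePoint F) (k : Fin 2) :
    homCoords (liftP1 L c) k = algebraMap F L (homCoords c k) := by
  cases c with
  | infty =>
    rw [show liftP1 L (∞ : OnePoint F) = ∞ from rfl]
    fin_cases k <;> simp
  | coe a =>
    rw [show liftP1 L (a : OnePoint F) = (algebraMap F L a : L) from rfl]
    fin_cases k <;> simp

theorem homEval_liftP1 (x : ι → OnePoint F) (p : MvPolynomial (ι × Fin 2) F) :
    homEval (fun i => liftP1 L (x i)) p = algebraMap F L (homEval x p) := by
  rw [homEval, homEval]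
  simp only [homCoords_liftP1]
  exact MvPolynomial.aeval_algebraMap_apply _ _ _

/-- The linear form whose zero locus is `x_i = c`. -/
noncomputable def pointForm (i : ι) (c : OnePoint F) : MvPolynomial (ι × Fin 2) F :=
  MvPolynomial.C (homCoords c 1) * MvPolynomial.X (i, 0) -
    MvPolynomial.C (homCoords c 0) * MvPolynomial.X (i, 1)

theorem homEval_pointForm_eq_zero_iff (x : ι → OnePoint L) (i : ι) (c : OnePoint F) :
    homEval x (pointForm i c) = 0 ↔ x i = liftP1 L c := by
  simp only [pointForm, _root_.map_sub, map_mul, homEval_C, homEval_X]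
  generalize x i = a
  cases a with
  | infty =>
    cases c with
    | infty => simp [liftP1]
    | coe c => simp [liftP1]
  | coe a =>
    cases c with
    | infty => simp [liftP1]
    | coe c => simp [liftP1, sub_eq_zero]

theorem multiHomog_pointForm [DecidableEq ι] (i : ι) (c : OnePoint F) :
    MultiHomog (pointForm i c) := by
  intro j
  refine ⟨if i = j then 1 else 0, ?_⟩
  have h : ∀ (a : F) (k : Fin 2), (MvPolynomial.C a * MvPolynomial.X (i, k)).IsWeightedHomogeneous
      (fun jk : ι × Fin 2 => if jk.1 = j then (1 : ℕ) else 0) (if i = j then 1 else 0) := by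
    intro a k
    have := (MvPolynomial.isWeightedHomogeneous_C
      (fun jk : ι × Fin 2 => if jk.1 = j then (1 : ℕ) else 0) a).mul
      (MvPolynomial.isWeightedHomogeneous_X F
      (fun jk : ι × Fin 2 => if jk.1 = j then (1 : ℕ) else 0) (i, k))
    simpa using this
  exact Submodule.sub_mem (MvPolynomial.weightedHomogeneousSubmodule F _ _) (h _ 0) (h _ 1)

theorem MultiHomog.mul [DecidableEq ι] {p q : MvPolynomial (ι × Fin 2) F} (hp : MultiHomog p)
    (hq : MultiHomog q) : MultiHomog (p * q) := by
  intro i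
  obtain ⟨d, hd⟩ := hp i
  obtain ⟨e, he⟩ := hq i
  exact ⟨d + e, hd.mul he⟩

/-- The set of `F`-points at which all multihomogeneous equations of a point over an extension
hold. -/
def locus (F : Type) {L ι : Type} [Field F] [Field L] [Algebra F L] [DecidableEq ι]
    (ξ : ι → OnePoint L) : Set (ι → OnePoint F) :=
  {x | ∀ p : MvPolynomial (ι × Fin 2) F, MultiHomog p → homEval ξ p = 0 → homEval x p = 0}

theorem nonempty_algHom_of_finiteType_field {K : Type} [Field K] [Algebra F K] [IsAlgClosed F]
    [Algebra.FiniteType F K] : Nonempty (K →ₐ[F] F) := by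
  have : Module.Finite F K := finite_of_finite_type_of_isJacobsonRing F K
  have hbij := IsAlgClosed.algebraMap_bijective_of_isIntegral (k := F) (K := K)
  exact ⟨(AlgEquiv.ofBijective (Algebra.ofId F K) hbij).symm.toAlgHom⟩

theorem nonempty_algHom_quotient {R : Type} [CommRing R] [Algebra F R] [IsAlgClosed F]
    [Algebra.FiniteType F R] (M : Ideal R) [hM : M.IsMaximal] : Nonempty (R →ₐ[F] F) := by
  have : Algebra.FiniteType F (R ⧸ M) :=
    Algebra.FiniteType.of_surjective (Ideal.Quotient.mkₐ F M) (Ideal.Quotient.mkₐ_surjective F M)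
  let _ : Field (R ⧸ M) := Ideal.Quotient.field M
  obtain ⟨g⟩ := nonempty_algHom_of_finiteType_field (F := F) (K := R ⧸ M)
  exact ⟨g.comp (Ideal.Quotient.mkₐ F M)⟩

theorem exists_algHom_apply_ne_zero [IsAlgClosed F] {s : Set L} (hs : s.Finite) {z : L}
    (hz : z ≠ 0) :
    ∃ (R : Subalgebra F L) (ψ : R →ₐ[F] F), s ⊆ R ∧ ∃ h : z ∈ R, ψ ⟨z, h⟩ ≠ 0 := by
  set T : Set L := insert z (insert z⁻¹ s) with hT
  have hfin : T.Finite := (hs.insert _).insert _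
  let R := Algebra.adjoin F T
  have : Algebra.FiniteType F R :=
    (Subalgebra.fg_iff_finiteType _).mp ((Subalgebra.fg_def).mpr ⟨T, hfin, rfl⟩)
  obtain ⟨M, hM⟩ := Ideal.exists_maximal R
  obtain ⟨ψ⟩ := nonempty_algHom_quotient (F := F) M
  have hzR : z ∈ R := Algebra.subset_adjoin (by simp [hT])
  have hzR' : z⁻¹ ∈ R := Algebra.subset_adjoin (by simp [hT])
  refine ⟨R, ψ, fun y hy =>
    Algebra.subset_adjoin (by simp [hT, hy]), hzR, fun h => ?_⟩
  have h1 : (⟨z, hzR⟩ : R) * ⟨z⁻¹, hzR'⟩ = 1 := Subtype.ext (mul_inv_cancel₀ hz)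
  have h2 := congrArg ψ h1
  rw [map_mul, h, zero_mul, _root_.map_one] at h2
  exact zero_ne_one h2

/-- The Nullstellensatz for points over extensions. -/
theorem exists_specialization [IsAlgClosed F] [Finite ι] (ξ : ι → OnePoint L)
    {p : MvPolynomial (ι × Fin 2) F} (hp : homEval ξ p ≠ 0) :
    ∃ x : ι → OnePoint F, homEval x p ≠ 0 ∧
      ∀ q : MvPolynomial (ι × Fin 2) F, homEval ξ q = 0 → homEval x q = 0 := by
  classical
  obtain ⟨R, ψ, hR, hz, hψ⟩ := exists_algHom_apply_ne_zero (F := F)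
    (Set.finite_range fun jk : ι × Fin 2 => homCoords (ξ jk.1) jk.2) hp
  let c : ι × Fin 2 → R := fun jk => ⟨homCoords (ξ jk.1) jk.2, hR ⟨jk, rfl⟩⟩
  let x : ι → OnePoint F := fun i => if ξ i = ∞ then ∞ else (ψ (c (i, 0)) : F)
  have hx : ∀ jk : ι × Fin 2, homCoords (x jk.1) jk.2 = ψ (c jk) := by
    rintro ⟨i, k⟩
    by_cases h : ξ i = ∞
    · have h0 : c (i, 0) = 1 := Subtype.ext (by simp [c, h])
      have h1 : c (i, 1) = 0 := Subtype.ext (by simp [c, h])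
      fin_cases k <;> simp [x, h, h0, h1]
    · obtain ⟨a, ha⟩ := OnePoint.ne_infty_iff_exists.mp h
      have h1 : c (i, 1) = 1 := Subtype.ext (by simp [c, ← ha])
      fin_cases k <;> simp [x, h, h1]
  have hc : ∀ q : MvPolynomial (ι × Fin 2) F, ((MvPolynomial.aeval c q : R) : L) = homEval ξ q := by
    intro q
    have := MvPolynomial.aeval_algebraMap_apply L c q
    exact this.symm
  have hxq : ∀ q : MvPolynomial (ι × Fin 2) F, homEval x q = ψ (MvPolynomial.aeval c q) := by
    intro q
    rw [homEval, funext hx]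
    exact (MvPolynomial.comp_aeval_apply (f := c) ψ q).symm
  refine ⟨x, ?_, fun q hq => ?_⟩
  · rw [hxq]
    have : MvPolynomial.aeval c p = ⟨homEval ξ p, hz⟩ := Subtype.ext (hc p)
    rwa [this]
  · have : MvPolynomial.aeval c q = 0 := Subtype.ext ((hc q).trans hq)
    rw [hxq, this, _root_.map_zero]

theorem isZarClosed_locus [DecidableEq ι] (ξ : ι → OnePoint L) : IsZarClosed (locus F ξ) := by
  refine ⟨⟨{p | MultiHomog p ∧ homEval ξ p = 0}, fun p hp => hp.1⟩, ?_⟩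
  ext x
  simp only [locus, ClosedSubvar.pts, Set.mem_ofPred_eq, vanishesAt_id_iff]
  exact ⟨fun h p hp => h p hp.1 hp.2, fun h p h1 h2 => h p ⟨h1, h2⟩⟩

theorem homEval_eq_zero_iff_forall_mem_locus [IsAlgClosed F] [Finite ι] [DecidableEq ι]
    (ξ : ι → OnePoint L) {p : MvPolynomial (ι × Fin 2) F} (hp : MultiHomog p) :
    homEval ξ p = 0 ↔ ∀ x ∈ locus F ξ, homEval x p = 0 := by
  refine ⟨fun h x hx => hx p hp h, fun h => ?_⟩
  by_contra hne
  obtain ⟨x, hx, hx'⟩ := exists_specialization ξ hne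
  exact hx (h x fun q _ hq => hx' q hq)

theorem locus_subset_locus_iff {L' : Type} [Field L'] [Algebra F L'] [IsAlgClosed F] [Finite ι]
    [DecidableEq ι] (ξ : ι → OnePoint L) (ξ' : ι → OnePoint L') :
    locus F ξ ⊆ locus F ξ' ↔ ∀ p : MvPolynomial (ι × Fin 2) F, MultiHomog p →
      homEval ξ' p = 0 → homEval ξ p = 0 := by
  refine ⟨fun h p hp hp' => ?_, fun h x hx p hp hp' => hx p hp (h p hp hp')⟩
  exact (homEval_eq_zero_iff_forall_mem_locus ξ hp).mpr fun x hx => h hx p hp hp'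

theorem irrSubvar_locus [IsAlgClosed F] [Finite ι] [DecidableEq ι] (ξ : ι → OnePoint L) :
    IrrSubvar (locus F ξ) := by
  refine ⟨?_, isZarClosed_locus ξ, ?_⟩
  · obtain ⟨x, -, hx⟩ := exists_specialization (F := F) ξ (p := 1) (by simp)
    exact ⟨x, fun q _ hq => hx q hq⟩
  · rintro _ _ ⟨Z₁, rfl⟩ ⟨Z₂, rfl⟩ h
    by_contra! hne
    obtain ⟨x₁, hx₁, h₁⟩ := Set.not_subset.mp hne.1
    obtain ⟨x₂, hx₂, h₂⟩ := Set.not_subset.mp hne.2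
    simp only [ClosedSubvar.pts, Set.mem_ofPred_eq, not_forall, vanishesAt_id_iff] at h₁ h₂
    obtain ⟨p₁, hp₁, h₁⟩ := h₁
    obtain ⟨p₂, hp₂, h₂⟩ := h₂
    have h3 : homEval ξ (p₁ * p₂) ≠ 0 := by
      rw [map_mul]
      exact mul_ne_zero (fun h0 => h₁ (hx₁ _ (Z₁.homog _ hp₁) h0))
        (fun h0 => h₂ (hx₂ _ (Z₂.homog _ hp₂) h0))
    obtain ⟨x, hx, hx'⟩ := exists_specialization ξ h3
    rw [map_mul] at hx
    rcases h (show x ∈ locus F ξ from fun q _ hq => hx' q hq) with hz | hz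
    · exact hx (by rw [(vanishesAt_id_iff _ _).mp (hz p₁ hp₁), zero_mul])
    · exact hx (by rw [(vanishesAt_id_iff _ _).mp (hz p₂ hp₂), mul_zero])

end Specialization

section GenericPoint

variable {F ι : Type} [Field F] [DecidableEq ι]

/-- The weight recording the degree in the pair of homogeneous coordinates of index `j`. -/
abbrev blockWeight (j : ι) : ι × Fin 2 → ℕ := fun jk => if jk.1 = j then 1 else 0

theorem isWeightedHomogeneous_blockWeight_X (j : ι) (jk : ι × Fin 2) :
    (MvPolynomial.X jk : MvPolynomial (ι × Fin 2) F).IsWeightedHomogeneous (blockWeight j)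
      (if jk.1 = j then 1 else 0) :=
  MvPolynomial.isWeightedHomogeneous_X F _ jk

/-- An affine polynomial in the coordinates from `A` has a multihomogenization of any large enough
degree. -/
theorem exists_homogenization [Finite ι] (A : Set ι) (q : MvPolynomial A F) {N : ℕ}
    (hN : q.totalDegree ≤ N) :
    ∃ p : MvPolynomial (ι × Fin 2) F,
      (∀ j, ∃ d, d = (open Classical in if j ∈ A then N else 0) ∧
        p.IsWeightedHomogeneous (blockWeight j) d) ∧
      ∀ (L : Type) [Field L] [Algebra F L] (x : ι → OnePoint L), (∀ i ∈ A, x i ≠ ∞) →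
        homEval x p = MvPolynomial.aeval (fun i : A => homCoords (x i) 0) q := by
  classical
  have := Fintype.ofFinite A
  refine ⟨∑ m ∈ q.support, MvPolynomial.C (q.coeff m) *
    ∏ i : A, (MvPolynomial.X (i.1, 0) ^ m i * MvPolynomial.X (i.1, 1) ^ (N - m i)), ?_, ?_⟩
  · intro j
    refine ⟨_, rfl, MvPolynomial.IsWeightedHomogeneous.sum _ _ _ fun m hm => ?_⟩
    refine MvPolynomial.IsWeightedHomogeneous.C_mul ?_ _
    have h1 : ∀ i : A, (MvPolynomial.X (i.1, 0) ^ m i * MvPolynomial.X (i.1, 1) ^ (N - m i) :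
        MvPolynomial (ι × Fin 2) F).IsWeightedHomogeneous (blockWeight j)
          (if i.1 = j then N else 0) := by
      intro i
      have hle : m i ≤ N := by
        refine le_trans ?_ hN
        refine le_trans ?_ (MvPolynomial.le_totalDegree hm)
        exact Finsupp.le_degree i m
      have h2 := ((isWeightedHomogeneous_blockWeight_X (F := F) j (i.1, 0)).pow (m i)).mul
        ((isWeightedHomogeneous_blockWeight_X (F := F) j (i.1, 1)).pow (N - m i))
      convert h2 using 1
      by_cases hij : i.1 = j
      · simp [hij]; omega
      · simp [hij]
    have h2 := MvPolynomial.IsWeightedHomogeneous.prod Finset.univ _ _ fun i _ => h1 i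
    convert h2 using 1
    by_cases hj : j ∈ A
    · rw [if_pos hj, Finset.sum_eq_single (⟨j, hj⟩ : A)]
      · simp
      · intro b _ hb
        exact if_neg fun h => hb (Subtype.ext h)
      · simp
    · rw [if_neg hj]
      refine (Finset.sum_eq_zero fun i _ => if_neg ?_).symm
      rintro rfl
      exact hj i.2
  · intro L _ _ x hx
    have h1 : ∀ i : A, homCoords (x i) 1 = 1 := by
      intro i
      obtain ⟨a, ha⟩ := OnePoint.ne_infty_iff_exists.mp (hx i i.2)
      rw [← ha]; rfl
    rw [MvPolynomial.aeval_def, MvPolynomial.eval₂_eq']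
    simp [h1]

theorem homEval_prod_pointForm_infty_ne_zero {L : Type} [Field L] [Algebra F L]
    (x : ι → OnePoint L) (S : Finset ι) :
    homEval x (∏ i ∈ S, pointForm (F := F) i ∞) ≠ 0 ↔ ∀ i ∈ S, x i ≠ ∞ := by
  rw [_root_.map_prod, Finset.prod_ne_zero_iff]
  refine forall₂_congr fun i _ => not_congr ?_
  rw [homEval_pointForm_eq_zero_iff]; rfl

theorem multiHomog_one : MultiHomog (1 : MvPolynomial (ι × Fin 2) F) := fun _ =>
  ⟨0, MvPolynomial.isWeightedHomogeneous_one F _⟩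

theorem MultiHomog.prod {κ : Type} (S : Finset κ) (p : κ → MvPolynomial (ι × Fin 2) F)
    (h : ∀ i ∈ S, MultiHomog (p i)) : MultiHomog (∏ i ∈ S, p i) := by
  classical
  induction S using Finset.induction_on with
  | empty => simpa using multiHomog_one
  | insert a S ha ih =>
    rw [Finset.prod_insert ha]
    exact (h a (Finset.mem_insert_self a S)).mul
      (ih fun i hi => h i (Finset.mem_insert_of_mem hi))

/-- Affine relations at a generic point are the relations that hold at the finite points of the
locus. -/
theorem aeval_homCoords_eq_zero_iff [IsAlgClosed F] [Finite ι] {L : Type} [Field L] [Algebra F L]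
    (ξ : ι → OnePoint L) (A : Set ι) (hA : ∀ i ∈ A, ξ i ≠ ∞) (q : MvPolynomial A F) :
    MvPolynomial.aeval (fun i : A => homCoords (ξ i) 0) q = 0 ↔
      ∀ x ∈ locus F ξ, (∀ i ∈ A, x i ≠ ∞) →
        MvPolynomial.aeval (fun i : A => homCoords (x i) 0) q = 0 := by
  classical
  have := Fintype.ofFinite ι
  obtain ⟨p, hp, hpe⟩ := exists_homogenization A q le_rfl
  have hpm : MultiHomog p := fun j => by
    obtain ⟨d, -, hd⟩ := hp j
    exact ⟨d, hd⟩
  rw [← hpe L ξ hA]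
  constructor
  · intro h x hx hxA
    rw [← hpe F x hxA]
    exact hx p hpm h
  · intro h
    set S : Finset ι := Finset.univ.filter (· ∈ A) with hS
    have h1 : homEval ξ (p * ∏ i ∈ S, pointForm (F := F) i ∞) = 0 := by
      refine (homEval_eq_zero_iff_forall_mem_locus ξ
        (hpm.mul (MultiHomog.prod _ _ fun i _ => multiHomog_pointForm i _))).mpr fun x hx => ?_
      rw [map_mul]
      by_cases hxA : ∀ i ∈ S, x i ≠ ∞
      · have hxA' : ∀ i ∈ A, x i ≠ ∞ := fun i hi => hxA i (by simpa [hS] using hi)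
        rw [hpe F x hxA', h x hx hxA', zero_mul]
      · rw [not_ne_iff.mp (mt (homEval_prod_pointForm_infty_ne_zero x S).mp hxA), mul_zero]
    rw [map_mul] at h1
    refine (mul_eq_zero.mp h1).resolve_right ?_
    exact (homEval_prod_pointForm_infty_ne_zero ξ S).mpr fun i hi => hA i (by simpa [hS] using hi)

/-- An irreducible subvariety is the locus of a point over a field extension. -/
theorem exists_eq_locus {T : Set (ι → OnePoint F)} (hT : IrrSubvar T) :
    ∃ (L : Type) (_ : Field L) (_ : Algebra F L) (ξ : ι → OnePoint L), T = locus F ξ := by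
  classical
  obtain ⟨hne, ⟨V, hV⟩, hirr⟩ := hT
  let P : Type := {p : MvPolynomial (ι × Fin 2) F // MultiHomog p ∧ ∃ x ∈ T, homEval x p ≠ 0}
  let N : P → Set (ι → OnePoint F) := fun p => {x | x ∈ T ∧ homEval x p.1 ≠ 0}
  have hcl : ∀ p : MvPolynomial (ι × Fin 2) F, MultiHomog p →
      IsZarClosed {x : ι → OnePoint F | homEval x p = 0} := by
    intro p hp
    refine ⟨⟨{p}, by rintro _ rfl; exact hp⟩, ?_⟩
    ext x
    simp [ClosedSubvar.pts, vanishesAt_id_iff]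
  have hdir : ∀ p q : P, ∃ r : P, N r ⊆ N p ∩ N q := by
    rintro ⟨p, hp, x, hx, hxp⟩ ⟨q, hq, y, hy, hyq⟩
    have h1 : ∃ z ∈ T, homEval z (p * q) ≠ 0 := by
      by_contra! hno
      rcases hirr _ _ (hcl p hp) (hcl q hq) (fun z hz => by
        have := hno z hz
        rw [map_mul] at this
        exact mul_eq_zero.mp this) with h | h
      · exact hxp (h hx)
      · exact hyq (h hy)
    refine ⟨⟨p * q, hp.mul hq, h1⟩, ?_⟩
    rintro z ⟨hz, hz'⟩
    change homEval z (p * q) ≠ 0 at hz'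
    rw [map_mul] at hz'
    exact ⟨⟨hz, left_ne_zero_of_mul hz'⟩, ⟨hz, right_ne_zero_of_mul hz'⟩⟩
  have : Nonempty P := ⟨⟨1, multiHomog_one, hne.some, hne.some_mem, by simp⟩⟩
  have hbot : (⨅ p : P, Filter.principal (N p)).NeBot := by
    refine Filter.iInf_neBot_of_directed ?_ ?_
    · intro p q
      obtain ⟨r, hr⟩ := hdir p q
      exact ⟨r, Filter.principal_mono.mpr fun x hx => (hr hx).1,
        Filter.principal_mono.mpr fun x hx => (hr hx).2⟩
    · rintro ⟨p, hp, x, hx, hxp⟩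
      exact Filter.principal_neBot_iff.mpr ⟨x, hx, hxp⟩
  let U := Ultrafilter.of (⨅ p : P, Filter.principal (N p))
  have hU : ∀ p : P, ∀ᶠ x in (U : Filter (ι → OnePoint F)), x ∈ N p := fun p =>
    Ultrafilter.of_le _ (Filter.mem_iInf_of_mem p (Filter.mem_principal_self _))
  let L := Filter.Germ (U : Filter (ι → OnePoint F)) F
  let φ : ((ι → OnePoint F) → F) →+* L := Filter.Germ.coeRingHom _
  let _ : Algebra F L := (φ.comp (Pi.constRingHom _ F)).toAlgebra
  have hφ : ∀ g : (ι → OnePoint F) → F, φ g = 0 ↔ ∀ᶠ x in (U : Filter (ι → OnePoint F)), g x = 0 :=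
    fun g => Filter.Germ.coe_eq
  let ξ : ι → OnePoint L := fun i =>
    if ∀ᶠ x in (U : Filter (ι → OnePoint F)), x i = ∞ then ∞
      else ((φ fun x => homCoords (x i) 0 : L) : OnePoint L)
  have hξ : ∀ jk : ι × Fin 2, homCoords (ξ jk.1) jk.2 = φ fun x => homCoords (x jk.1) jk.2 := by
    rintro ⟨i, k⟩
    by_cases h : ∀ᶠ x in (U : Filter (ι → OnePoint F)), x i = ∞
    · have h1 : ξ i = ∞ := if_pos h
      simp only [h1]
      fin_cases k
      · exact (Filter.Germ.coe_eq.mpr (h.mono fun x hx => by simp [hx]) : _).symm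
      · exact (Filter.Germ.coe_eq.mpr (h.mono fun x hx => by simp [hx]) : _).symm
    · have h1 : ξ i = ((φ fun x => homCoords (x i) 0 : L) : OnePoint L) := if_neg h
      simp only [h1]
      rw [← Ultrafilter.eventually_not] at h
      fin_cases k
      · rfl
      · refine (Filter.Germ.coe_eq.mpr (h.mono fun x hx => ?_) : _).symm
        obtain ⟨a, ha⟩ := OnePoint.ne_infty_iff_exists.mp hx
        simp [← ha]
  have hev : ∀ p : MvPolynomial (ι × Fin 2) F, homEval ξ p = φ fun x => homEval x p := by
    intro p
    induction p using MvPolynomial.induction_on with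
    | C a => simp only [homEval_C]; rfl
    | add p q hp hq =>
      simp only [_root_.map_add, hp, hq]
      exact (_root_.map_add φ _ _).symm
    | mul_X p jk hp =>
      simp only [map_mul, hp, homEval_X, hξ]
      exact (map_mul φ _ _).symm
  have hgen : ∀ p : MvPolynomial (ι × Fin 2) F, MultiHomog p →
      (homEval ξ p = 0 ↔ ∀ x ∈ T, homEval x p = 0) := by
    intro p hp
    rw [hev, hφ]
    constructor
    · intro h
      by_contra! hno
      obtain ⟨x, hx⟩ := (h.and (hU ⟨p, hp, hno⟩)).exists
      exact hx.2.2 hx.1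
    · intro h
      exact (hU ⟨1, multiHomog_one, hne.some, hne.some_mem, by simp⟩).mono fun x hx => h x hx.1
  refine ⟨L, inferInstance, inferInstance, ξ, ?_⟩
  ext x
  constructor
  · exact fun hx p hp h => (hgen p hp).mp h x hx
  · intro hx
    rw [hV]
    intro p hp
    rw [vanishesAt_id_iff]
    refine hx p (V.homog p hp) ((hgen p (V.homog p hp)).mpr fun y hy => ?_)
    rw [hV] at hy
    exact (vanishesAt_id_iff p y).mp (hy p hp)

end GenericPoint

section PointRank

variable {F ι : Type} [Field F]

/-- The coordinates with index in `s` of a point of `(P^1(L))^ι` are finite and algebraically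
independent over `F`. -/
def IsIndepCoords (F : Type) {L ι : Type} [Field F] [Field L] [Algebra F L] (ξ : ι → OnePoint L)
    (s : Set ι) : Prop :=
  (∀ i ∈ s, ξ i ≠ ∞) ∧ AlgebraicIndepOn F (fun i => homCoords (ξ i) 0) s

open Classical in
/-- The maximal number of algebraically independent coordinates of a point. -/
noncomputable def pointRank (F : Type) {L ι : Type} [Field F] [Field L] [Algebra F L] [Fintype ι]
    (ξ : ι → OnePoint L) : ℕ :=
  (Finset.univ.filter fun s : Finset ι => IsIndepCoords F ξ s).sup Finset.card

theorem IsIndepCoords.card_le_pointRank {L : Type} [Field L] [Algebra F L] [Fintype ι]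
    {ξ : ι → OnePoint L} {s : Finset ι} (hs : IsIndepCoords F ξ s) : s.card ≤ pointRank F ξ := by
  classical
  exact Finset.le_sup (f := Finset.card) (by simpa using hs)

theorem exists_isIndepCoords_card_eq {L : Type} [Field L] [Algebra F L] [Fintype ι]
    (ξ : ι → OnePoint L) : ∃ s : Finset ι, IsIndepCoords F ξ s ∧ s.card = pointRank F ξ := by
  classical
  have h0 : IsIndepCoords F ξ (∅ : Finset ι) := by
    refine ⟨by simp, ?_⟩
    have : IsEmpty ((∅ : Finset ι) : Set ι) := by simp
    exact (algebraicIndependent_empty_type_iff).mpr (algebraMap F L).injective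
  obtain ⟨s, hs, he⟩ := Finset.exists_mem_eq_sup
    (Finset.univ.filter fun s : Finset ι => IsIndepCoords F ξ s) ⟨∅, by simpa using h0⟩ Finset.card
  exact ⟨s, by simpa using hs, he.symm⟩

theorem IsIndepCoords.of_locus_subset {L L' : Type} [Field L] [Algebra F L] [Field L']
    [Algebra F L'] [IsAlgClosed F] [Finite ι] [DecidableEq ι] {ξ : ι → OnePoint L}
    {ξ' : ι → OnePoint L'} (h : locus F ξ ⊆ locus F ξ') {s : Set ι} (hs : IsIndepCoords F ξ s) :
    IsIndepCoords F ξ' s := by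
  have h1 := (locus_subset_locus_iff ξ ξ').mp h
  have hfin : ∀ i ∈ s, ξ' i ≠ ∞ := by
    intro i hi h2
    refine hs.1 i hi ?_
    have := h1 (pointForm i ∞) (multiHomog_pointForm i _)
      ((homEval_pointForm_eq_zero_iff _ _ _).mpr h2)
    exact (homEval_pointForm_eq_zero_iff _ _ _).mp this
  refine ⟨hfin, algebraicIndependent_iff.mpr fun q hq => ?_⟩
  obtain ⟨p, hp, hpe⟩ := exists_homogenization s q le_rfl
  refine algebraicIndependent_iff.mp hs.2 q ?_
  rw [← hpe L ξ hs.1]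
  refine h1 p (fun j => ?_) (by rw [hpe L' ξ' hfin]; exact hq)
  obtain ⟨d, -, hd⟩ := hp j
  exact ⟨d, hd⟩

theorem pointRank_mono {L L' : Type} [Field L] [Algebra F L] [Field L']
    [Algebra F L'] [IsAlgClosed F] [Fintype ι] [DecidableEq ι] {ξ : ι → OnePoint L}
    {ξ' : ι → OnePoint L'} (h : locus F ξ ⊆ locus F ξ') : pointRank F ξ ≤ pointRank F ξ' := by
  obtain ⟨s, hs, he⟩ := exists_isIndepCoords_card_eq (F := F) ξ
  rw [← he]
  exact (hs.of_locus_subset h).card_le_pointRank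

theorem homEval_mem_of_forall {L : Type} [Field L] [Algebra F L] (ξ : ι → OnePoint L)
    (M : IntermediateField F L) (h : ∀ i, ξ i ≠ ∞ → homCoords (ξ i) 0 ∈ M)
    (p : MvPolynomial (ι × Fin 2) F) : homEval ξ p ∈ M := by
  have hX : ∀ jk : ι × Fin 2, homCoords (ξ jk.1) jk.2 ∈ M := by
    rintro ⟨i, k⟩
    by_cases hi : ξ i = ∞
    · fin_cases k
      · simp [hi]
      · simp [hi]
    · fin_cases k
      · exact h i hi
      · obtain ⟨a, ha⟩ := OnePoint.ne_infty_iff_exists.mp hi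
        simp [← ha]
  induction p using MvPolynomial.induction_on with
  | C a => rw [homEval_C]; exact M.algebraMap_mem a
  | add p q hp hq => rw [_root_.map_add]; exact add_mem hp hq
  | mul_X p jk hp => rw [map_mul, homEval_X]; exact mul_mem hp (hX jk)

/-- An element algebraic over `F[ξ_i : i ∈ s]` satisfies a relation that can be homogenized:
homogeneous coefficients of a common multidegree, the constant one being nonzero. -/
theorem exists_homogeneous_relation {L : Type} [Field L] [Algebra F L] [Finite ι] [DecidableEq ι]
    {ξ : ι → OnePoint L} {s : Set ι} (hs : ∀ i ∈ s, ξ i ≠ ∞) {w : L} (hw : w ≠ 0)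
    (hmem : w ∈ relAlgClosure F ((fun i => homCoords (ξ i) 0) '' s)) :
    ∃ (k : ℕ) (c : ℕ → MvPolynomial (ι × Fin 2) F) (q₀ : MvPolynomial s F),
      (∀ j, ∃ d, ∀ e, (c e).IsWeightedHomogeneous (blockWeight j) d) ∧
      ∑ e ∈ Finset.range (k + 1), homEval ξ (c e) * w ^ e = 0 ∧ homEval ξ (c 0) ≠ 0 ∧
      ∀ (L' : Type) [Field L'] [Algebra F L'] (x : ι → OnePoint L'), (∀ i ∈ s, x i ≠ ∞) →
        homEval x (c 0) = MvPolynomial.aeval (fun i : s => homCoords (x i) 0) q₀ := by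
  classical
  rw [mem_relAlgClosure_iff] at hmem
  obtain ⟨P, hP0, hP⟩ := hmem.exists_nonzero_coeff_and_aeval_eq_zero
    (mem_nonZeroDivisors_of_ne_zero hw)
  have hlift : ∀ e, ∃ q : MvPolynomial s F,
      MvPolynomial.aeval (fun i : s => homCoords (ξ i) 0) q = (P.coeff e : L) := by
    intro e
    have h1 : Algebra.adjoin F ((fun i => homCoords (ξ i) 0) '' s) =
        (MvPolynomial.aeval fun i : s => homCoords (ξ i) 0).range := by
      rw [Set.image_eq_range, Algebra.adjoin_range_eq_range_aeval]
    exact h1.le (P.coeff e).2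
  choose q hq using hlift
  set k := P.natDegree
  let N := (Finset.range (k + 1)).sup fun e => (q e).totalDegree
  have hhom : ∀ e, ∃ p : MvPolynomial (ι × Fin 2) F,
      (∀ j, p.IsWeightedHomogeneous (blockWeight j) (if j ∈ s then N else 0)) ∧
      (e ∈ Finset.range (k + 1) → ∀ (L' : Type) [Field L'] [Algebra F L'] (x : ι → OnePoint L'),
        (∀ i ∈ s, x i ≠ ∞) →
          homEval x p = MvPolynomial.aeval (fun i : s => homCoords (x i) 0) (q e)) := by
    intro e
    by_cases he : e ∈ Finset.range (k + 1)
    · obtain ⟨p, hp, hpe⟩ := exists_homogenization s (q e)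
        (Finset.le_sup (f := fun e => (q e).totalDegree) he)
      refine ⟨p, fun j => ?_, fun _ => hpe⟩
      obtain ⟨d, hd, hpd⟩ := hp j
      convert hpd
      rw [hd]
    · exact ⟨0, fun j => MvPolynomial.isWeightedHomogeneous_zero _ _ _, fun h => absurd h he⟩
  choose c hc hce using hhom
  have h0 : 0 ∈ Finset.range (k + 1) := by simp
  refine ⟨k, c, q 0, fun j => ⟨_, fun e => hc e j⟩, ?_, ?_, hce 0 h0⟩
  · rw [aeval_eq_sum_range] at hP
    rw [← hP]
    refine Finset.sum_congr rfl fun e he => ?_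
    rw [hce e he L ξ hs, hq, Algebra.smul_def]
    rfl
  · rw [hce 0 h0 L ξ hs, hq]
    exact fun h => hP0 (Subtype.ext h)

theorem pointRank_lt {L L' : Type} [Field L] [Algebra F L] [Field L']
    [Algebra F L'] [IsAlgClosed F] [Fintype ι] [DecidableEq ι] {ξ : ι → OnePoint L}
    {ξ' : ι → OnePoint L'} (h : locus F ξ ⊆ locus F ξ') (hne : ¬ locus F ξ' ⊆ locus F ξ) :
    pointRank F ξ < pointRank F ξ' := by
  classical
  by_contra hlt
  obtain ⟨s, hs, he⟩ := exists_isIndepCoords_card_eq (F := F) ξ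
  have hs' := hs.of_locus_subset h
  have h1 := (locus_subset_locus_iff ξ ξ').mp h
  rw [locus_subset_locus_iff] at hne
  push Not at hne
  obtain ⟨q, hq, hqξ, hqξ'⟩ := hne
  set M := relAlgClosure F ((fun i => homCoords (ξ' i) 0) '' (s : Set ι)) with hM
  have hmem : ∀ i, ξ' i ≠ ∞ → homCoords (ξ' i) 0 ∈ M := by
    intro i hi
    by_cases his : i ∈ s
    · exact subset_relAlgClosure _ ⟨i, his, rfl⟩
    by_contra hno
    rw [hM, mem_relAlgClosure_iff] at hno
    have h2 : IsIndepCoords F ξ' ((insert i s : Finset ι) : Set ι) := by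
      rw [Finset.coe_insert]
      refine ⟨?_, hs'.2.insert hno⟩
      rintro j (rfl | hj)
      exacts [hi, hs'.1 j hj]
    have h3 := h2.card_le_pointRank
    rw [Finset.card_insert_of_notMem his] at h3
    omega
  choose d hd using hq
  choose κ hκ using fun i => homCoords_ne_zero (ξ i)
  let ℓ : MvPolynomial (ι × Fin 2) F := ∏ i, MvPolynomial.X (i, κ i) ^ d i
  have hℓ : ∀ j, ℓ.IsWeightedHomogeneous (blockWeight j) (d j) := by
    intro j
    have := MvPolynomial.IsWeightedHomogeneous.prod Finset.univ
      (fun i => (MvPolynomial.X (i, κ i) ^ d i : MvPolynomial (ι × Fin 2) F)) _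
      fun i _ => (isWeightedHomogeneous_blockWeight_X (F := F) j (i, κ i)).pow (d i)
    convert this using 1
    simp
  have hℓξ : homEval ξ ℓ ≠ 0 := by
    simp only [ℓ, _root_.map_prod, _root_.map_pow, homEval_X]
    exact Finset.prod_ne_zero_iff.mpr fun i _ => pow_ne_zero _ (hκ i)
  have hℓξ' : homEval ξ' ℓ ≠ 0 := fun h0 => hℓξ (h1 ℓ (fun j => ⟨_, hℓ j⟩) h0)
  obtain ⟨k, c, q₀, hc, hrel, hc0, hq₀⟩ := exists_homogeneous_relation (F := F) hs'.1
    (div_ne_zero hqξ' hℓξ')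
    (div_mem (homEval_mem_of_forall ξ' M hmem q) (homEval_mem_of_forall ξ' M hmem ℓ))
  let H : MvPolynomial (ι × Fin 2) F :=
    ∑ e ∈ Finset.range (k + 1), c e * (q ^ e * ℓ ^ (k - e))
  have hH : MultiHomog H := by
    intro j
    obtain ⟨N, hN⟩ := hc j
    refine ⟨N + k * d j, MvPolynomial.IsWeightedHomogeneous.sum _ _ _ fun e he => ?_⟩
    have h2 := (hN e).mul (((hd j).pow e).mul ((hℓ j).pow (k - e)))
    convert h2 using 2
    have : e ≤ k := by have := Finset.mem_range.mp he; omega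
    rw [smul_eq_mul, smul_eq_mul, ← add_mul]
    congr 1
    omega
  have hHξ' : homEval ξ' H = 0 := by
    rw [← zero_mul (homEval ξ' ℓ ^ k), ← hrel, Finset.sum_mul, _root_.map_sum]
    refine Finset.sum_congr rfl fun e he => ?_
    have : e ≤ k := by have := Finset.mem_range.mp he; omega
    rw [map_mul, map_mul, _root_.map_pow, _root_.map_pow, div_pow, mul_assoc]
    congr 1
    rw [← pow_sub_mul_pow (homEval ξ' ℓ) this]
    field_simp
  have hHξ := h1 H hH hHξ'
  have hHξ0 : homEval ξ H = homEval ξ (c 0) * homEval ξ ℓ ^ k := by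
    simp only [H, _root_.map_sum]
    rw [Finset.sum_eq_single 0]
    · simp
    · intro e _ he
      rw [map_mul, map_mul, _root_.map_pow, hqξ, zero_pow he, zero_mul, mul_zero]
    · simp
  rw [hHξ0] at hHξ
  have h2 := (mul_eq_zero.mp hHξ).resolve_right (pow_ne_zero _ hℓξ)
  rw [hq₀ L ξ hs.1] at h2
  have h3 := algebraicIndependent_iff.mp hs.2 q₀ h2
  rw [hq₀ L' ξ' hs'.1, h3, _root_.map_zero] at hc0
  exact hc0 rfl

/-- The dimension of a locus is at most the rank of its generic point. -/
theorem varDim_locus_le {L : Type} [Field L] [Algebra F L] [IsAlgClosed F] [Fintype ι]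
    [DecidableEq ι] (ξ : ι → OnePoint L) :
    varDim (locus F ξ) ≤ (((pointRank F ξ : ℕ) : ℕ∞) : WithBot ℕ∞) := by
  have hex : ∀ T : {T : Set (ι → OnePoint F) // IrrSubvar T ∧ T ⊆ locus F ξ},
      ∃ r : Fin (pointRank F ξ + 1), ∃ (L : Type) (_ : Field L) (_ : Algebra F L)
        (ζ : ι → OnePoint L), T.1 = locus F ζ ∧ (r : ℕ) = pointRank F ζ := by
    rintro ⟨T, hT, hTξ⟩
    obtain ⟨L', _, _, ζ, rfl⟩ := exists_eq_locus hT
    exact ⟨⟨pointRank F ζ, Nat.lt_succ_of_le (pointRank_mono hTξ)⟩, L', _, _, ζ, rfl, rfl⟩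
  choose r hr using hex
  have hmono : StrictMono r := by
    rintro T T' hlt
    obtain ⟨L₁, _, _, ζ₁, h₁, e₁⟩ := hr T
    obtain ⟨L₂, _, _, ζ₂, h₂, e₂⟩ := hr T'
    rw [Fin.lt_def, e₁, e₂]
    have h3 : T.1 ⊆ T'.1 ∧ ¬ T'.1 ⊆ T.1 := lt_iff_le_not_ge.mp hlt
    rw [h₁, h₂] at h3
    exact pointRank_lt h3.1 h3.2
  refine iSup_le fun p => ?_
  have h1 := (p.map r hmono).length_lt_card
  rw [Fintype.card_fin] at h1
  exact WithBot.coe_le_coe.mpr (Nat.cast_le.mpr (Nat.le_of_lt_succ h1))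

end PointRank

section Hybrid

variable {F L ι : Type} [Field F] [Field L] [Algebra F L]

theorem homEval_eq_sum (x : ι → OnePoint L) [Fintype ι] (p : MvPolynomial (ι × Fin 2) F) :
    homEval x p = ∑ m ∈ p.support, algebraMap F L (p.coeff m) *
      ∏ i, ∏ k, homCoords (x i) k ^ m (i, k) := by
  rw [homEval, MvPolynomial.aeval_def, MvPolynomial.eval₂_eq']
  refine Finset.sum_congr rfl fun m _ => ?_
  rw [Fintype.prod_prod_type]

open Classical in
/-- If the coordinates in a block depend only on one transcendental and the others are
independent of it, then the block can be specialized separately. -/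
theorem homEval_ite_eq_zero [IsAlgClosed F] [CharZero F] [Fintype ι] [DecidableEq ι]
    (B : IntermediateField F L) {t : L} (ht : Transcendental B t) (ξ : ι → OnePoint L)
    (P : ι → Prop) (hP : ∀ i, P i → ∀ k, homCoords (ξ i) k ∈ relAlgClosure F {t})
    (hB : ∀ i, ¬ P i → ∀ k, homCoords (ξ i) k ∈ B) (x : ι → OnePoint F)
    (hx : (fun i : {i // P i} => x i) ∈ locus F (fun i : {i // P i} => ξ i))
    {p : MvPolynomial (ι × Fin 2) F} (hp : MultiHomog p) (h : homEval ξ p = 0) :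
    homEval (fun i => if P i then liftP1 L (x i) else ξ i) p = 0 := by
  let a : (ι × Fin 2 →₀ ℕ) → relAlgClosure F {t} := fun m =>
    ∏ i : {i // P i}, ∏ k, (⟨homCoords (ξ i) k, hP i i.2 k⟩ : relAlgClosure F {t}) ^ m (i.1, k)
  let b : (ι × Fin 2 →₀ ℕ) → B := fun m => algebraMap F B (p.coeff m) *
    ∏ i : {i // ¬ P i}, ∏ k, (⟨homCoords (ξ i) k, hB i i.2 k⟩ : B) ^ m (i.1, k)
  let y : (ι × Fin 2 →₀ ℕ) → F := fun m =>
    ∏ i : {i // P i}, ∏ k, homCoords (x i) k ^ m (i.1, k)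
  have ha : ∀ m, ((a m : relAlgClosure F {t}) : L) =
      ∏ i : {i // P i}, ∏ k, homCoords (ξ i) k ^ m (i.1, k) := by
    intro m
    simp [a]
  have hb : ∀ m, ((b m : B) : L) = algebraMap F L (p.coeff m) *
      ∏ i : {i // ¬ P i}, ∏ k, homCoords (ξ i) k ^ m (i.1, k) := by
    intro m
    simp [b]
  have key := sum_smul_eq_zero_of_relations B ht p.support a b ?_ y ?_
  · rw [homEval_eq_sum, ← key]
    refine Finset.sum_congr rfl fun m _ => ?_
    rw [← Fintype.prod_subtype_mul_prod_subtype P, hb, Algebra.smul_def]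
    have h1 : ∏ i : {i // P i}, ∏ k, homCoords (if P i then liftP1 L (x i) else ξ i) k ^ m (i.1, k)
        = algebraMap F L (y m) := by
      simp only [y, _root_.map_prod, _root_.map_pow]
      refine Finset.prod_congr rfl fun i _ => Finset.prod_congr rfl fun k _ => ?_
      rw [if_pos i.2, homCoords_liftP1]
    have h2 : ∏ i : {i // ¬ P i},
        ∏ k, homCoords (if P i then liftP1 L (x i) else ξ i) k ^ m (i.1, k)
        = ∏ i : {i // ¬ P i}, ∏ k, homCoords (ξ i) k ^ m (i.1, k) := by
      refine Finset.prod_congr rfl fun i _ => Finset.prod_congr rfl fun k _ => ?_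
      rw [if_neg i.2]
    rw [h1, h2]
    ring
  · rw [← h, homEval_eq_sum]
    refine Finset.sum_congr rfl fun m _ => ?_
    rw [← Fintype.prod_subtype_mul_prod_subtype P, ha, hb]
    ring
  · intro w hw
    let mon : (ι × Fin 2 →₀ ℕ) → MvPolynomial ({i // P i} × Fin 2) F := fun m =>
      ∏ i : {i // P i}, ∏ k, MvPolynomial.X (i, k) ^ m (i.1, k)
    let q : MvPolynomial ({i // P i} × Fin 2) F :=
      ∑ m ∈ p.support, MvPolynomial.C (w m) * mon m
    have hmon : ∀ (K : Type) [Field K] [Algebra F K] (z : {i // P i} → OnePoint K) m,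
        homEval z (mon m) = ∏ i : {i // P i}, ∏ k, homCoords (z i) k ^ m (i.1, k) := by
      intro K _ _ z m
      simp only [mon, _root_.map_prod, _root_.map_pow, homEval_X]
    have hq : MultiHomog q := by
      intro j
      obtain ⟨d, hd⟩ := hp j
      refine ⟨d, MvPolynomial.IsWeightedHomogeneous.sum _ _ _ fun m hm => ?_⟩
      have h1 := hd (MvPolynomial.mem_support_iff.mp hm)
      have h2 : (mon m).IsWeightedHomogeneous (blockWeight j) d := by
        have h3 := MvPolynomial.IsWeightedHomogeneous.prod (w := blockWeight j) Finset.univ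
          (fun i : {i // P i} => ∏ k, (MvPolynomial.X (i, k) : MvPolynomial _ F) ^ m (i.1, k)) _
          fun i _ => MvPolynomial.IsWeightedHomogeneous.prod Finset.univ _ _
            fun k _ => (isWeightedHomogeneous_blockWeight_X (F := F) j (i, k)).pow (m (i.1, k))
        convert h3 using 1
        rw [← h1, Finsupp.weight_apply, Finsupp.sum_fintype _ _ (by simp),
          Fintype.sum_prod_type]
        rw [Fintype.sum_eq_single j.1 fun i hi => by simp [hi],
          Fintype.sum_eq_single j fun i hi => by simp [hi]]
        simp
      have h3 := (MvPolynomial.isWeightedHomogeneous_C (blockWeight j) (w m)).mul h2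
      rwa [zero_add] at h3
    have h4 := hx q hq ?_
    · simpa [q, hmon, y] using h4
    · rw [← hw]
      simp only [q, _root_.map_sum, map_mul, homEval_C, hmon, Algebra.smul_def, ha]

end Hybrid

section Blocks

variable {F L ι κ : Type} [Field F] [Field L] [Algebra F L]

theorem relAlgClosure_mono {s u : Set L} (h : s ⊆ u) : relAlgClosure F s ≤ relAlgClosure F u := by
  intro z hz
  rw [mem_relAlgClosure_iff_mem_closure] at hz ⊢
  exact Matroid.closure_subset_closure _ h hz

theorem mem_relAlgClosure_trans {s : Set L} {w z : L} (hz : z ∈ relAlgClosure F {w})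
    (hw : w ∈ relAlgClosure F s) : z ∈ relAlgClosure F s := by
  rw [mem_relAlgClosure_iff_mem_closure] at hz hw ⊢
  exact Matroid.closure_subset_closure_of_subset_closure (Set.singleton_subset_iff.mpr hw) hz

theorem mem_relAlgClosure_symm {w z : L} (hz : z ∈ relAlgClosure F {w})
    (hz' : z ∉ relAlgClosure F (∅ : Set L)) : w ∈ relAlgClosure F {z} := by
  rw [mem_relAlgClosure_iff_mem_closure] at hz hz' ⊢
  have h := Matroid.closure_exchange (M := AlgebraicIndependent.matroid F L) (X := ∅) (e := z)
    (f := w) ⟨by simpa using hz, hz'⟩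
  simpa using h.1

theorem notMem_relAlgClosure_image_compl {t : κ → L} (ht : AlgebraicIndependent F t) (k : κ) :
    t k ∉ relAlgClosure F (t '' {k}ᶜ) := by
  rw [mem_relAlgClosure_iff]
  exact ht.transcendental_adjoin (by simp)

theorem MultiHomog.rename_subtype [DecidableEq ι] {P : ι → Prop}
    {p : MvPolynomial ({i // P i} × Fin 2) F} (hp : MultiHomog p) :
    MultiHomog (MvPolynomial.rename (fun ik => (ik.1.1, ik.2)) p :
      MvPolynomial (ι × Fin 2) F) := by
  intro j
  by_cases hj : P j
  · obtain ⟨d, hd⟩ := hp ⟨j, hj⟩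
    refine ⟨d, fun m hm => ?_⟩
    obtain ⟨u, rfl, hu⟩ := MvPolynomial.coeff_rename_ne_zero _ _ _ hm
    rw [← hd hu, Finsupp.weight_apply, Finsupp.weight_apply,
      Finsupp.sum_mapDomain_index (by simp) (by intros; simp only [smul_eq_mul, add_mul])]
    simp [Subtype.ext_iff]
  · refine ⟨0, fun m hm => ?_⟩
    obtain ⟨u, rfl, hu⟩ := MvPolynomial.coeff_rename_ne_zero _ _ _ hm
    rw [Finsupp.weight_apply, Finsupp.sum_mapDomain_index (by simp) (by intros; simp only [smul_eq_mul, add_mul])]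
    refine Finset.sum_eq_zero fun ik _ => ?_
    have : ik.1.1 ≠ j := fun h => hj (h ▸ ik.1.2)
    simp [this]

theorem homEval_rename_subtype {P : ι → Prop} (x : ι → OnePoint L)
    (p : MvPolynomial ({i // P i} × Fin 2) F) :
    homEval x (MvPolynomial.rename (fun ik => (ik.1.1, ik.2)) p : MvPolynomial (ι × Fin 2) F) =
      homEval (fun i : {i // P i} => x i) p := by
  rw [homEval, homEval, MvPolynomial.aeval_rename]
  rfl

theorem restrict_mem_locus [DecidableEq ι] {ξ : ι → OnePoint L} {x : ι → OnePoint F}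
    (hx : x ∈ locus F ξ) (P : ι → Prop) :
    (fun i : {i // P i} => x i) ∈ locus F (fun i : {i // P i} => ξ i) := by
  intro p hp h
  rw [← homEval_rename_subtype]
  exact hx _ hp.rename_subtype (by rwa [homEval_rename_subtype])

/-- The coordinates of the point `ξ` outside the disjoint nonempty blocks `J k` are constant, and
those in the block `J k` are nonconstant and algebraic over `F(t k)`, for algebraically independent
elements `t k`. -/
structure IsBlockPoint (F : Type) {L ι κ : Type} [Field F] [Field L] [Algebra F L]
    (ξ : ι → OnePoint L) (t : κ → L) (J : κ → Finset ι) : Prop where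
  indep : AlgebraicIndependent F t
  const : ∀ i, (∀ k, i ∉ J k) → ∃ c, ξ i = liftP1 L (c : OnePoint F)
  ne_infty : ∀ k, ∀ i ∈ J k, ξ i ≠ ∞
  mem : ∀ k, ∀ i ∈ J k, homCoords (ξ i) 0 ∈ relAlgClosure F {t k}
  notMem : ∀ k, ∀ i ∈ J k, homCoords (ξ i) 0 ∉ relAlgClosure F (∅ : Set L)
  nonempty : ∀ k, (J k).Nonempty
  eq_of_mem : ∀ k k' i, i ∈ J k → i ∈ J k' → k = k'

theorem homCoords_mem_of_zero {a : OnePoint L} (M : IntermediateField F L) (ha : a ≠ ∞)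
    (h : homCoords a 0 ∈ M) (k : Fin 2) : homCoords a k ∈ M := by
  obtain ⟨b, rfl⟩ := OnePoint.ne_infty_iff_exists.mp ha
  fin_cases k
  · exact h
  · simp

theorem homCoords_liftP1_mem (M : IntermediateField F L) (c : OnePoint F) (k : Fin 2) :
    homCoords (liftP1 L c) k ∈ M := by
  rw [homCoords_liftP1]
  exact M.algebraMap_mem _

open Classical in
/-- Specialization of the coordinates belonging to the blocks with index in `S`. -/
noncomputable def specializeBlocks (ξ : ι → OnePoint L) (J : κ → Finset ι) (S : Finset κ)
    (x : ι → OnePoint F) : ι → OnePoint L :=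
  fun i => if ∃ k ∈ S, i ∈ J k then liftP1 L (x i) else ξ i

theorem IsBlockPoint.homEval_specializeBlocks_insert [IsAlgClosed F] [CharZero F] [Fintype ι]
    [DecidableEq ι] [DecidableEq κ] {ξ : ι → OnePoint L} {t : κ → L} {J : κ → Finset ι} (h : IsBlockPoint F ξ t J)
    {x : ι → OnePoint F} {S : Finset κ} {k : κ}
    (hk : k ∉ S) (hx : (fun i : J k => x i) ∈ locus F (fun i : J k => ξ i))
    {p : MvPolynomial (ι × Fin 2) F} (hp : MultiHomog p)
    (h0 : homEval (specializeBlocks ξ J S x) p = 0) :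
    homEval (specializeBlocks ξ J (insert k S) x) p = 0 := by
  have hS : ∀ i ∈ J k, specializeBlocks ξ J S x i = ξ i := by
    intro i hi
    rw [specializeBlocks, if_neg]
    rintro ⟨k', hk', hi'⟩
    exact hk (h.eq_of_mem k k' i hi hi' ▸ hk')
  have hres : (fun i : J k => specializeBlocks ξ J S x i) = fun i : J k => ξ i :=
    funext fun i => hS i i.2
  have key := homEval_ite_eq_zero (relAlgClosure F (t '' {k}ᶜ))
    (transcendental_relAlgClosure (notMem_relAlgClosure_image_compl h.indep k))
    (specializeBlocks ξ J S x) (fun i => i ∈ J k)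
    (fun i hi => by
      rw [hS i hi]
      exact homCoords_mem_of_zero _ (h.ne_infty k i hi) (h.mem k i hi))
    (fun i hi => by
      rw [specializeBlocks]
      split_ifs with hi'
      · exact homCoords_liftP1_mem _ _
      by_cases hi'' : ∃ k', i ∈ J k'
      · obtain ⟨k', hik'⟩ := hi''
        have hne : k' ≠ k := by rintro rfl; exact hi hik'
        refine homCoords_mem_of_zero _ (h.ne_infty k' i hik') ?_
        exact relAlgClosure_mono (by rintro _ rfl; exact ⟨k', hne, rfl⟩) (h.mem k' i hik')
      · obtain ⟨c, hc⟩ := h.const i (not_exists.mp hi'')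
        rw [hc]
        exact homCoords_liftP1_mem _ _)
    x (by rw [hres]; exact hx) hp h0
  rw [← key]
  congr 2
  ext1 i
  by_cases hi : i ∈ J k
  · simp [specializeBlocks, hi]
  · simp [specializeBlocks, hi]

theorem IsBlockPoint.homEval_specializeBlocks [IsAlgClosed F] [CharZero F] [Fintype ι]
    [DecidableEq ι] {ξ : ι → OnePoint L} {t : κ → L} {J : κ → Finset ι} (h : IsBlockPoint F ξ t J)
    {x : ι → OnePoint F} {S : Finset κ}
    (hx : ∀ k ∈ S, (fun i : J k => x i) ∈ locus F (fun i : J k => ξ i))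
    {p : MvPolynomial (ι × Fin 2) F} (hp : MultiHomog p) (h0 : homEval ξ p = 0) :
    homEval (specializeBlocks ξ J S x) p = 0 := by
  classical
  induction S using Finset.induction_on with
  | empty =>
    have : specializeBlocks ξ J ∅ x = ξ := by
      ext1 i
      simp [specializeBlocks]
    rwa [this]
  | insert k S hk ih =>
    exact h.homEval_specializeBlocks_insert hk (hx k (Finset.mem_insert_self k S)) hp
      (ih fun k' hk' => hx k' (Finset.mem_insert_of_mem hk'))

/-- The locus of a block point is the product of the loci of the blocks. -/
theorem IsBlockPoint.mem_locus_iff [IsAlgClosed F] [CharZero F] [Fintype ι] [Fintype κ]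
    [DecidableEq ι] {ξ : ι → OnePoint L} {t : κ → L} {J : κ → Finset ι} (h : IsBlockPoint F ξ t J)
    (x : ι → OnePoint F) :
    x ∈ locus F ξ ↔ (∀ i, (∀ k, i ∉ J k) → ξ i = liftP1 L (x i)) ∧
      ∀ k, (fun i : J k => x i) ∈ locus F (fun i : J k => ξ i) := by
  constructor
  · refine fun hx => ⟨fun i hi => ?_, fun k => restrict_mem_locus hx (fun i => i ∈ J k)⟩
    obtain ⟨c, hc⟩ := h.const i hi
    have h1 := hx (pointForm i c) (multiHomog_pointForm i c)
      ((homEval_pointForm_eq_zero_iff _ _ _).mpr hc)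
    rw [homEval_pointForm_eq_zero_iff] at h1
    rw [hc, h1]
    generalize c = c
    cases c <;> rfl
  · rintro ⟨hc, hx⟩ p hp h0
    have h1 := h.homEval_specializeBlocks (S := Finset.univ) (fun k _ => hx k) hp h0
    have h2 : specializeBlocks ξ J Finset.univ x = fun i => liftP1 L (x i) := by
      ext1 i
      by_cases hi : ∃ k, i ∈ J k
      · simp [specializeBlocks, hi]
      · simp only [specializeBlocks, Finset.mem_univ, true_and, if_neg hi]
        exact hc i (not_exists.mp hi)
    rw [h2, homEval_liftP1] at h1
    exact (map_eq_zero_iff _ (algebraMap F L).injective).mp h1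

theorem IsBlockPoint.pointRank_le [Fintype ι] [Fintype κ]
    {ξ : ι → OnePoint L} {t : κ → L} {J : κ → Finset ι} [IsAlgClosed F]
    (h : IsBlockPoint F ξ t J) : pointRank F ξ ≤ Fintype.card κ := by
  classical
  obtain ⟨s, ⟨hfin, hs⟩, he⟩ := exists_isIndepCoords_card_eq (F := F) ξ
  rw [← he]
  have hex : ∀ i : s, ∃ k, i.1 ∈ J k := by
    rintro ⟨i, hi⟩
    by_contra hno
    obtain ⟨c, hc⟩ := h.const i (not_exists.mp hno)
    have h1 := notMem_relAlgClosure_image_compl hs ⟨i, hi⟩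
    refine h1 ?_
    simp only [hc]
    exact homCoords_liftP1_mem _ _ _
  choose κ' hκ using hex
  have hinj : Function.Injective κ' := by
    intro i i' hii
    by_contra hne
    have h1 := notMem_relAlgClosure_image_compl hs i
    have h2 := h.mem _ _ (hκ i)
    rw [hii] at h2
    have h3 := mem_relAlgClosure_trans h2
      (mem_relAlgClosure_symm (h.mem _ _ (hκ i')) (h.notMem _ _ (hκ i')))
    refine h1 (relAlgClosure_mono ?_ h3)
    rintro _ rfl
    exact ⟨i', Ne.symm hne, rfl⟩
  have := Fintype.card_le_of_injective _ hinj
  simpa using this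

/-- The dimension of the locus of a block point is the number of blocks. -/
theorem IsBlockPoint.varDim_locus [IsAlgClosed F] [CharZero F] [Fintype ι] [DecidableEq ι] {r : ℕ}
    {ξ : ι → OnePoint L} {t : Fin r → L} {J : Fin r → Finset ι}
    (h : IsBlockPoint F ξ t J) : varDim (locus F ξ) = ((r : ℕ∞) : WithBot ℕ∞) := by
  apply le_antisymm
  · refine (varDim_locus_le ξ).trans ?_
    have := h.pointRank_le
    rw [Fintype.card_fin] at this
    exact WithBot.coe_le_coe.mpr (Nat.cast_le.mpr this)
  obtain ⟨x, hx⟩ := (irrSubvar_locus (F := F) ξ).1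
  have hxk : ∀ k, (fun i : J k => x i) ∈ locus F (fun i : J k => ξ i) :=
    fun k => restrict_mem_locus hx (fun i => i ∈ J k)
  let S : Fin (r + 1) → Finset (Fin r) := fun j => Finset.univ.filter fun k => (k : ℕ) < r - j
  let η : Fin (r + 1) → ι → OnePoint L := fun j => specializeBlocks ξ J (S j) x
  have hηle : ∀ j, locus F (η j) ⊆ locus F ξ := by
    intro j
    rw [locus_subset_locus_iff]
    exact fun p hp h0 => h.homEval_specializeBlocks (fun k _ => hxk k) hp h0
  have hη : ∀ j : Fin r, locus F (η j.castSucc) ⊆ locus F (η j.succ) := by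
    intro j
    rw [locus_subset_locus_iff]
    have hS : S j.castSucc = insert ⟨r - (j + 1), by omega⟩ (S j.succ) := by
      ext k
      simp only [S, Finset.mem_filter, Finset.mem_univ, true_and, Finset.mem_insert, Fin.ext_iff,
        Fin.val_castSucc, Fin.val_succ]
      omega
    simp only [η]
    rw [hS]
    exact fun p hp h0 => h.homEval_specializeBlocks_insert (by simp [S]) (hxk _) hp h0
  have hlt : ∀ j : Fin r, ¬ locus F (η j.succ) ⊆ locus F (η j.castSucc) := by
    intro j hle
    rw [locus_subset_locus_iff] at hle
    let k : Fin r := ⟨r - (j + 1), by omega⟩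
    obtain ⟨i, hi⟩ := h.nonempty k
    have h1 := hle (pointForm i (x i)) (multiHomog_pointForm _ _) (by
      rw [homEval_pointForm_eq_zero_iff]
      simp only [η, specializeBlocks]
      rw [if_pos ⟨k, by simp [S, k]; omega, hi⟩])
    rw [homEval_pointForm_eq_zero_iff] at h1
    simp only [η, specializeBlocks] at h1
    rw [if_neg] at h1
    · refine h.notMem k i hi ?_
      rw [h1]
      exact homCoords_liftP1_mem _ _ _
    · rintro ⟨k', hk', hi'⟩
      have := h.eq_of_mem k k' i hi hi'
      subst this
      simp [S, k] at hk'
  let T : Fin (r + 1) → {T : Set (ι → OnePoint F) // IrrSubvar T ∧ T ⊆ locus F ξ} :=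
    fun j => ⟨locus F (η j), irrSubvar_locus _, hηle j⟩
  have hT : StrictMono T := Fin.strictMono_iff_lt_succ.mpr fun j =>
    lt_iff_le_not_ge.mpr ⟨hη j, hlt j⟩
  exact Order.LTSeries.length_le_krullDim (LTSeries.mk r T hT)

end Blocks

section Dynamics

variable {F ι : Type} [Field F]

theorem splitMap_iterate_apply (f : F[X]) (N : ℕ) (x : ι → OnePoint F) (i : ι) :
    (splitMap f)^[N] x i = (OnePoint.map fun a => f.eval a)^[N] (x i) := by
  induction N generalizing x with
  | zero => rfl
  | succ N ih => rw [Function.iterate_succ_apply, ih, Function.iterate_succ_apply]; rfl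

theorem onePointMap_iterate_coe (f : F[X]) (N : ℕ) (a : F) :
    (OnePoint.map fun a => f.eval a)^[N] (a : OnePoint F) =
      ((f.comp^[N] X).eval a : F) := by
  rw [iterate_comp_eval, eval_X]
  induction N generalizing a with
  | zero => rfl
  | succ N ih => rw [Function.iterate_succ_apply, OnePoint.map_some, ih,
      Function.iterate_succ_apply]

theorem onePointMap_iterate_infty (f : F[X]) (N : ℕ) :
    (OnePoint.map fun a => f.eval a)^[N] (∞ : OnePoint F) = ∞ := by
  induction N with
  | zero => rfl
  | succ N ih => rw [Function.iterate_succ_apply, OnePoint.map_infty, ih]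

theorem splitMap_iterate_ne_infty_iff (f : F[X]) (N : ℕ) (x : ι → OnePoint F) (i : ι) :
    (splitMap f)^[N] x i ≠ ∞ ↔ x i ≠ ∞ := by
  rw [splitMap_iterate_apply]
  generalize x i = a
  cases a with
  | infty => simp [onePointMap_iterate_infty]
  | coe a => simp [onePointMap_iterate_coe]

theorem homCoords_splitMap_iterate (f : F[X]) (N : ℕ) {x : ι → OnePoint F} {i : ι}
    (h : x i ≠ ∞) :
    homCoords ((splitMap f)^[N] x i) 0 = aeval (homCoords (x i) 0) (f.comp^[N] X) := by
  rw [splitMap_iterate_apply]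
  obtain ⟨a, ha⟩ := OnePoint.ne_infty_iff_exists.mp h
  rw [← ha, onePointMap_iterate_coe]
  simp [coe_aeval_eq_eval]

theorem iterate_comp_add (f : F[X]) (m a : ℕ) :
    f.comp^[m + a] X = (f.comp^[m] X).comp (f.comp^[a] X) := by
  induction m with
  | zero => simp
  | succ m ih =>
    rw [Nat.add_right_comm, Function.iterate_succ_apply', ih, Function.iterate_succ_apply',
      comp_assoc]

/-- The equations satisfied by the images of the finite coordinates of the generic point under an
iterate are those of the image of its locus. -/
theorem aeval_iterate_eq_zero_iff {L : Type} [Field L] [Algebra F L] [IsAlgClosed F] [Finite ι]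
    [DecidableEq ι] (f : F[X]) (N : ℕ) (ξ : ι → OnePoint L) (A : Set ι) (hA : ∀ i ∈ A, ξ i ≠ ∞)
    (q : MvPolynomial A F) :
    MvPolynomial.aeval (fun i : A => aeval (homCoords (ξ i) 0) (f.comp^[N] X)) q = 0 ↔
      ∀ x ∈ (splitMap f)^[N] '' locus F ξ, (∀ i ∈ A, x i ≠ ∞) →
        MvPolynomial.aeval (fun i : A => homCoords (x i) 0) q = 0 := by
  have hb : ∀ (K : Type) [Field K] [Algebra F K] (z : A → K),
      MvPolynomial.aeval (fun i : A => aeval (z i) (f.comp^[N] X)) q =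
        MvPolynomial.aeval z (MvPolynomial.bind₁
          (fun i : A => aeval (MvPolynomial.X i : MvPolynomial A F) (f.comp^[N] X)) q) := by
    intro K _ _ z
    rw [MvPolynomial.aeval_bind₁]
    congr 2
    ext1 i
    rw [← Polynomial.aeval_algHom_apply, MvPolynomial.aeval_X]
  rw [hb, aeval_homCoords_eq_zero_iff ξ A hA, Set.forall_mem_image]
  refine forall₂_congr fun x _ => ?_
  have h1 : (∀ i ∈ A, (splitMap f)^[N] x i ≠ ∞) ↔ ∀ i ∈ A, x i ≠ ∞ :=
    forall₂_congr fun i _ => splitMap_iterate_ne_infty_iff f N x i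
  rw [h1]
  refine forall_congr' fun hx => ?_
  rw [← hb]
  have h2 : (fun i : A => homCoords ((splitMap f)^[N] x i) 0) =
      fun i : A => aeval (homCoords (x i) 0) (f.comp^[N] X) :=
    funext fun i => homCoords_splitMap_iterate f N (hx i i.2)
  rw [h2]

end Dynamics

section Assembly

variable {F : Type} [Field F] [IsAlgClosed F]

theorem notMem_and_mem_relAlgClosure_aeval {L : Type} [Field L] [Algebra F L] {z : L} (h : F[X])
    (hh : 0 < h.natDegree) (hz : z ∉ relAlgClosure F (∅ : Set L)) :
    aeval z h ∉ relAlgClosure F (∅ : Set L) ∧ z ∈ relAlgClosure F {aeval z h} := by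
  have h1 : aeval z h ∉ relAlgClosure F (∅ : Set L) := by
    intro h2
    obtain ⟨c, hc⟩ := mem_relAlgClosure_empty_iff.mp h2
    refine hz (mem_relAlgClosure_of_isAlgebraic
      (fun a => (relAlgClosure F (∅ : Set L)).algebraMap_mem a) ⟨h - C c, ?_, by simp [hc]⟩)
    intro h0
    rw [sub_eq_zero.mp h0, natDegree_C] at hh
    exact lt_irrefl _ hh
  refine ⟨h1, mem_relAlgClosure_symm ?_ h1⟩
  have h2 : z ∈ relAlgClosure F {z} := subset_relAlgClosure _ rfl
  change aeval ((relAlgClosure F {z}).val ⟨z, h2⟩) h ∈ _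
  rw [aeval_algHom_apply]
  exact Subtype.property _

/-- The generic point of a preperiodic subvariety has a block decomposition. -/
theorem exists_isBlockPoint [CharZero F] {ι : Type} [Fintype ι] [DecidableEq ι] {f : F[X]}
    (hdis : IsDisintegratedAux f) {V : Set (ι → OnePoint F)} (hV : IrrSubvar V)
    (hpre : SubvarPreperiodic f V) :
    ∃ (L : Type) (_ : Field L) (_ : Algebra F L) (ξ : ι → OnePoint L) (r : ℕ) (t : Fin r → L)
      (J : Fin r → Finset ι), V = locus F ξ ∧ IsBlockPoint F ξ t J := by
  classical
  obtain ⟨L, _, _, ξ, rfl⟩ := exists_eq_locus hV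
  obtain ⟨a, m, hm, hper⟩ := hpre
  rw [← Set.image_comp, ← Function.iterate_add] at hper
  let A : Set ι := {i | ξ i ≠ ∞}
  let z : ι → L := fun i => homCoords (ξ i) 0
  let y : A → L := fun i => aeval (z i) (f.comp^[a] X)
  have hdeg : ∀ N, (f.comp^[N] X).natDegree = f.natDegree ^ N := fun N => by
    simp
  have hg : 2 ≤ (f.comp^[m] X).natDegree := by
    rw [hdeg]
    exact hdis.1.trans (Nat.le_self_pow (by omega) _)
  have hno : ¬ ∃ (r : ℕ) (P Q : F[X]) (c : F), 1 ≤ r ∧ P ≠ 0 ∧ Q ≠ 0 ∧ c ≠ 0 ∧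
      P.comp (f.comp^[m] X) * Q * derivative (f.comp^[m] X) ^ r =
        C c * (P * Q.comp (f.comp^[m] X)) := by
    rintro ⟨r, P, Q, c, hr, hP, hQ, hc, h⟩
    exact hdis.2
      (isSpecialPolyAux_of_iterate_functional_equation hdis.1 hP hQ hr hm hc h)
  have hrel : ∀ q : MvPolynomial A F, MvPolynomial.aeval y q = 0 ↔
      MvPolynomial.aeval (fun i => aeval (y i) (f.comp^[m] X)) q = 0 := by
    intro q
    have h1 : (fun i : A => aeval (y i) (f.comp^[m] X)) =
        fun i : A => aeval (homCoords (ξ i) 0) (f.comp^[m + a] X) := by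
      ext1 i
      rw [iterate_comp_add, aeval_comp]
    rw [h1, aeval_iterate_eq_zero_iff f (m + a) ξ A fun i hi => hi, hper]
    exact aeval_iterate_eq_zero_iff f a ξ A (fun i hi => hi) q
  obtain ⟨B, hB, hspan⟩ := exists_blocks_of_relations hg hno y hrel
  have hpos : 0 < (f.comp^[a] X).natDegree := by
    rw [hdeg]
    exact Nat.pow_pos (by have := hdis.1; omega)
  have hzy : ∀ i : A, z i ∉ relAlgClosure F (∅ : Set L) →
      y i ∉ relAlgClosure F (∅ : Set L) ∧ z i ∈ relAlgClosure F {y i} :=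
    fun i hi => notMem_and_mem_relAlgClosure_aeval _ hpos hi
  have := Fintype.ofFinite B
  let e : Fin (Fintype.card B) ≃ B := (Fintype.equivFin B).symm
  let t : Fin (Fintype.card B) → L := fun k => y (e k)
  have ht : AlgebraicIndependent F t := hB.comp e e.injective
  let J : Fin (Fintype.card B) → Finset ι := fun k => Finset.univ.filter fun i =>
    ξ i ≠ ∞ ∧ z i ∈ relAlgClosure F {t k} ∧ z i ∉ relAlgClosure F (∅ : Set L)
  have hJ : ∀ k i, i ∈ J k ↔
      ξ i ≠ ∞ ∧ z i ∈ relAlgClosure F {t k} ∧ z i ∉ relAlgClosure F (∅ : Set L) := by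
    simp [J]
  refine ⟨L, _, _, ξ, Fintype.card B, t, J, rfl, ht, ?_, fun k i hi => ((hJ k i).mp hi).1,
    fun k i hi => ((hJ k i).mp hi).2.1, fun k i hi => ((hJ k i).mp hi).2.2, ?_, ?_⟩
  · intro i hi
    by_cases hinf : ξ i = ∞
    · exact ⟨∞, hinf⟩
    by_cases hz : z i ∈ relAlgClosure F (∅ : Set L)
    · obtain ⟨c, hc⟩ := mem_relAlgClosure_empty_iff.mp hz
      obtain ⟨b, hb⟩ := OnePoint.ne_infty_iff_exists.mp hinf
      refine ⟨(c : F), ?_⟩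
      simp only [z, ← hb, homCoords_coe, Matrix.cons_val_zero] at hc
      rw [← hb, ← hc]
      rfl
    · obtain ⟨h1, h2⟩ := hzy ⟨i, hinf⟩ hz
      obtain ⟨b, hb, h3⟩ := (hspan ⟨i, hinf⟩).resolve_left h1
      refine absurd ((hJ (e.symm ⟨b, hb⟩) i).mpr ⟨hinf, ?_, hz⟩) (hi _)
      simp only [t, Equiv.apply_symm_apply]
      exact mem_relAlgClosure_trans h2 h3
  · intro k
    refine ⟨(e k).1.1, (hJ _ _).mpr ⟨(e k).1.2, ?_⟩⟩
    have h1 : z (e k).1.1 ∉ relAlgClosure F (∅ : Set L) := by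
      intro h
      refine notMem_relAlgClosure_image_compl ht k (relAlgClosure_mono (Set.empty_subset _) ?_)
      obtain ⟨c, hc⟩ := mem_relAlgClosure_empty_iff.mp h
      simp only [t, y, ← hc]
      rw [aeval_algebraMap_apply]
      exact (relAlgClosure F (∅ : Set L)).algebraMap_mem _
    exact ⟨(hzy _ h1).2, h1⟩
  · intro k k' i hi hi'
    by_contra hne
    obtain ⟨-, h1, h2⟩ := (hJ _ _).mp hi
    obtain ⟨-, h3, -⟩ := (hJ _ _).mp hi'
    refine notMem_relAlgClosure_image_compl ht k
      (relAlgClosure_mono ?_ (mem_relAlgClosure_trans (mem_relAlgClosure_symm h1 h2) h3))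
    rintro _ rfl
    exact ⟨k', Ne.symm hne, rfl⟩

end Assembly

section Constant

variable {F : Type} [Field F]

theorem apply_eq_of_mem_locus {L ι : Type} [Field L] [Algebra F L] [DecidableEq ι]
    {ξ : ι → OnePoint L} {x : ι → OnePoint F} (hx : x ∈ locus F ξ) {i : ι} {c : OnePoint F}
    (hc : ξ i = liftP1 L c) : x i = c := by
  have h1 := hx (pointForm i c) (multiHomog_pointForm i c)
    ((homEval_pointForm_eq_zero_iff _ _ _).mpr hc)
  rw [homEval_pointForm_eq_zero_iff] at h1
  rw [h1]
  cases c <;> rfl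

theorem p1Preperiodic_of_forall_apply_eq {ι : Type} {f : F[X]} {V : Set (ι → OnePoint F)}
    (hne : V.Nonempty) (hpre : SubvarPreperiodic f V) {i : ι} {c : OnePoint F}
    (hc : ∀ x ∈ V, x i = c) : P1Preperiodic f c := by
  obtain ⟨a, m, hm, hper⟩ := hpre
  obtain ⟨x, hx⟩ := hne
  have h1 : (splitMap f)^[m] ((splitMap f)^[a] x) ∈ (splitMap f)^[a] '' V := by
    rw [← hper]
    exact ⟨_, ⟨x, hx, rfl⟩, rfl⟩
  obtain ⟨x', hx', h2⟩ := h1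
  refine ⟨a, m, hm, ?_⟩
  have h3 := congrFun h2 i
  rw [splitMap_iterate_apply, splitMap_iterate_apply, splitMap_iterate_apply, hc x hx,
    hc x' hx'] at h3
  exact h3.symm


end Constant

/-- **Product decomposition of irreducible preperiodic subvarieties** (Proposition 2.6).

Let `F` be an algebraically closed field of characteristic 0, `n ≥ 2`, `f ∈ F[X]` a
disintegrated polynomial of degree at least 2, `φ = (f,…,f)`, and `V` an irreducible
`φ`-preperiodic subvariety of `(P^1_F)^n` with `l = dim V > 0`. Let `I_V` be the set of
indices `i` such that `V ⊆ {x_i = ζ_i}` with `ζ_i` an `f`-preperiodic point. Then there is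
a partition of `I ∖ I_V` into subsets `J_1, …, J_l` such that, under the canonical
isomorphism `(P^1)^n ≅ (P^1)^{I_V} × (P^1)^{J_1} × … × (P^1)^{J_l}`,
`V = (∏_{i ∈ I_V} {ζ_i}) × V_1 × … × V_l`, where each `V_k` is an `(f,…,f)`-preperiodic
curve in `(P^1)^{J_k}`. -/
theorem preperiodic_subvariety_product_of_curves
    (F : Type) [Field F] [IsAlgClosed F] [CharZero F]
    (n : ℕ) (hn : 2 ≤ n)
    (f : Polynomial F) (hf : 2 ≤ f.natDegree) (hdis : IsDisintegratedAux f)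
    (V : Set (Fin n → OnePoint F)) (hVirr : IrrSubvar V)
    (hVpre : SubvarPreperiodic f V)
    (l : ℕ) (hl : 0 < l) (hdim : varDim V = ((l : ℕ∞) : WithBot ℕ∞)) :
    ∃ J : Fin l → Finset (Fin n),
      (∀ k k' : Fin l, k ≠ k' → Disjoint (J k) (J k')) ∧
      (∀ i : Fin n, (¬ memIVpre f V i) ↔ ∃ k : Fin l, i ∈ J k) ∧
      ∃ ζ : Fin n → OnePoint F,
        (∀ i : Fin n, memIVpre f V i → P1Preperiodic f (ζ i)) ∧
        ∃ Vk : ∀ k : Fin l, Set (↥(J k) → OnePoint F),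
          (∀ k : Fin l, IrrSubvar (Vk k) ∧
            varDim (Vk k) = ((1 : ℕ∞) : WithBot ℕ∞) ∧
            SubvarPreperiodic f (Vk k)) ∧
          ∀ x : Fin n → OnePoint F,
            x ∈ V ↔ ((∀ i : Fin n, memIVpre f V i → x i = ζ i) ∧
              ∀ k : Fin l, (fun j : ↥(J k) => x j.1) ∈ Vk k) := by
  classical
  obtain ⟨L, _, _, ξ, r, t, J, rfl, h⟩ := exists_isBlockPoint hdis hVirr hVpre
  have hr : r = l := by
    have h1 := h.varDim_locus.symm.trans hdim
    exact Nat.cast_inj.mp (WithBot.coe_inj.mp h1)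
  subst hr
  obtain ⟨x₀, hx₀⟩ := hVirr.1
  have hconst : ∀ i, memIVpre f (locus F ξ) i ↔ ∀ k, i ∉ J k := by
    intro i
    constructor
    · rintro ⟨c, -, hc⟩ k hk
      have h1 : homEval ξ (pointForm i c) = 0 := by
        rw [homEval_eq_zero_iff_forall_mem_locus ξ (multiHomog_pointForm i c)]
        intro x hx
        rw [homEval_pointForm_eq_zero_iff, hc x hx]
        cases c <;> rfl
      rw [homEval_pointForm_eq_zero_iff] at h1
      refine h.notMem k i hk ?_
      rw [h1]
      exact homCoords_liftP1_mem _ _ _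
    · intro hi
      obtain ⟨c, hc⟩ := h.const i hi
      have h1 : ∀ x ∈ locus F ξ, x i = c := fun x hx => apply_eq_of_mem_locus hx hc
      exact ⟨c, p1Preperiodic_of_forall_apply_eq hVirr.1 hVpre h1, h1⟩
  refine ⟨J, fun k k' hne => Finset.disjoint_left.mpr fun i hi hi' =>
      hne (h.eq_of_mem k k' i hi hi'), fun i => ?_, x₀, ?_, fun k => locus F fun j : J k => ξ j, fun k => ⟨irrSubvar_locus _, ?_, ?_⟩,
    fun x => ?_⟩
  · rw [hconst]
    push Not
    rfl
  · rintro i ⟨c, hc, hVc⟩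
    rwa [hVc x₀ hx₀]
  · have h1 : IsBlockPoint F (fun j : J k => ξ j) (fun _ : Fin 1 => t k)
        (fun _ => Finset.univ) :=
      { indep := h.indep.comp (fun _ => k) (Function.injective_of_subsingleton _)
        const := fun i hi => absurd (Finset.mem_univ i) (hi 0)
        ne_infty := fun _ i _ => h.ne_infty k i i.2
        mem := fun _ i _ => h.mem k i i.2
        notMem := fun _ i _ => h.notMem k i i.2
        nonempty := fun _ => by
          obtain ⟨i, hi⟩ := h.nonempty k
          exact ⟨⟨i, hi⟩, Finset.mem_univ _⟩
        eq_of_mem := fun _ _ _ _ _ => Subsingleton.elim _ _ }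
    exact h1.varDim_locus
  · have himg : (locus F fun j : J k => ξ j) =
        (fun (x : Fin n → OnePoint F) (j : J k) => x j) '' locus F ξ := by
      ext w
      constructor
      · intro hw
        have hx₁ := (h.mem_locus_iff x₀).mp hx₀
        let x : Fin n → OnePoint F := fun i => if hi : i ∈ J k then w ⟨i, hi⟩ else x₀ i
        refine ⟨x, (h.mem_locus_iff x).mpr ⟨fun i hi => ?_, fun k' => ?_⟩, ?_⟩
        · simp only [x, dif_neg (hi k)]
          exact hx₁.1 i hi
        · by_cases hk : k' = k
          · subst hk
            convert hw using 2 with j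
            simp [x]
          · convert hx₁.2 k' using 2 with j
            exact dif_neg fun hj => hk (h.eq_of_mem k' k j j.2 hj)
        · ext1 j
          simp [x]
      · rintro ⟨x, hx, rfl⟩
        exact restrict_mem_locus hx (fun i => i ∈ J k)
    have hcomm : ∀ (N : ℕ) (S : Set (Fin n → OnePoint F)),
        (splitMap f)^[N] '' ((fun (x : Fin n → OnePoint F) (j : J k) => x j) '' S) =
          (fun (x : Fin n → OnePoint F) (j : J k) => x j) '' ((splitMap f)^[N] '' S) := by
      intro N S
      rw [Set.image_image, Set.image_image]
      refine Set.image_congr fun x _ => ?_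
      ext1 j
      rw [splitMap_iterate_apply, splitMap_iterate_apply]
    obtain ⟨a, m, hm, hper⟩ := hVpre
    refine ⟨a, m, hm, ?_⟩
    change (splitMap f)^[m] '' ((splitMap f)^[a] '' (locus F fun j : J k => ξ j)) =
      (splitMap f)^[a] '' (locus F fun j : J k => ξ j)
    rw [himg, hcomm, hcomm, hper]
  · have hx₁ := (h.mem_locus_iff x₀).mp hx₀
    rw [h.mem_locus_iff x]
    refine and_congr (forall_congr' fun i => ?_) Iff.rfl
    rw [hconst]
    refine forall_congr' fun hi => ?_
    rw [hx₁.1 i hi]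
    exact (Option.map_injective (algebraMap F L).injective).eq_iff.trans eq_comm
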